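/- Let N be an odd positive integer, 𝔄 = [𝔞₁,…,𝔞ₙ] a tuple with all 𝔞ₖ ∈ 𝔈₂, F ∈ ℤ[X₁,…,Xₙ], and α an element of the upper half-plane that is imaginary quadratic, i.e. [ℚ(α):ℚ] = 2. Then T_{𝔄,F}(α) is an algebraic integer, i.e. integral over ℤ. -/

import Mathlib

open scoped MatrixGroups
open Complex

/-- The Weierstrass ℘-function of the lattice `L_τ = ℤ + ℤτ`. -/
noncomputable def wp (τ z : ℂ) : ℂ :=
  1 / z ^ 2 + ∑' p : {p : ℤ × ℤ // p ≠ 0},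
    (1 / (z - ((p.1.1 : ℂ) + (p.1.2 : ℂ) * τ)) ^ 2 - 1 / ((p.1.1 : ℂ) + (p.1.2 : ℂ) * τ) ^ 2)

/-- The function `W_𝔞` for the triple `𝔞 = [a₁,a₂,a₃]`. -/
noncomputable def Wfun (N : ℕ) (a₁ a₂ a₃ : ℤ) (τ : ℂ) : ℂ :=
  (wp τ ((a₁ : ℂ) / N) - wp τ ((a₃ : ℂ) / N)) / (wp τ ((a₂ : ℂ) / N) - wp τ ((a₃ : ℂ) / N))

/-- Möbius action of an integral 2×2 matrix on ℂ. -/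
noncomputable def moebius (A : Matrix (Fin 2) (Fin 2) ℤ) (τ : ℂ) : ℂ :=
  ((A 0 0 : ℂ) * τ + (A 0 1 : ℂ)) / ((A 1 0 : ℂ) * τ + (A 1 1 : ℂ))

/-- `𝔖_N = (ℤ/Nℤ)ˣ/{±1}`. -/
abbrev SNgroup (N : ℕ) := (ZMod N)ˣ ⧸ (Subgroup.closure ({-1} : Set (ZMod N)ˣ))

/-- The triple `𝔞 = [a₁,a₂,a₃]` is in `𝔈`. -/
def memE (N : ℕ) (a : ℤ × ℤ × ℤ) : Prop :=
  0 < a.1 ∧ 0 < a.2.1 ∧ 0 < a.2.2 ∧ 2 * a.1 ≤ (N : ℤ) ∧ 2 * a.2.1 ≤ (N : ℤ) ∧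
    2 * a.2.2 ≤ (N : ℤ) ∧ a.1 ≠ a.2.1 ∧ a.1 ≠ a.2.2 ∧ a.2.1 ≠ a.2.2

def memE1 (N : ℕ) (a : ℤ × ℤ × ℤ) : Prop :=
  memE N a ∧ IsCoprime (a.1 * a.2.1 * a.2.2) (N : ℤ)

def memE2 (N : ℕ) (a : ℤ × ℤ × ℤ) : Prop :=
  memE1 N a ∧ IsCoprime (a.1 - a.2.2) (N : ℤ) ∧ IsCoprime (a.1 + a.2.2) (N : ℤ) ∧
    IsCoprime (a.2.1 - a.2.2) (N : ℤ) ∧ IsCoprime (a.2.1 + a.2.2) (N : ℤ)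

/-- `M` is a lift to `Γ₀(N)` of `diag(λ⁻¹, λ)` for the class `s = λ ∈ 𝔖_N`. -/
def IsDiagLift (N : ℕ) (M : SL(2, ℤ)) (s : SNgroup N) : Prop :=
  ∃ u : (ZMod N)ˣ, (QuotientGroup.mk u : SNgroup N) = s ∧
    ((M 0 0 : ℤ) : ZMod N) = ((u⁻¹ : (ZMod N)ˣ) : ZMod N) ∧
    ((M 0 1 : ℤ) : ZMod N) = 0 ∧ ((M 1 0 : ℤ) : ZMod N) = 0 ∧
    ((M 1 1 : ℤ) : ZMod N) = (u : ZMod N)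

/-- The function `T_{𝔄,F}`. -/
noncomputable def Tfun (N : ℕ) {n : ℕ} (A : Fin n → ℤ × ℤ × ℤ)
    (F : MvPolynomial (Fin n) ℤ) (M : SNgroup N → SL(2, ℤ)) (τ : ℂ) : ℂ :=
  ∑ᶠ s : SNgroup N, MvPolynomial.aeval
    (fun i => Wfun N (A i).1 (A i).2.1 (A i).2.2 (moebius ((M s : SL(2, ℤ)) : Matrix (Fin 2) (Fin 2) ℤ) τ)) F

/-- The matrix `B(t,u,v,k)`. -/
def Bmat (t : ℕ) (u v k : ℤ) : Matrix (Fin 2) (Fin 2) ℤ :=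
  !![u, (u * v - 1) / (t : ℤ) + u * k; (t : ℤ), v + (t : ℤ) * k]

/-- `{a}` : the representative of `±a mod N` in `(0, N/2]` (paper's `{·}`). -/
def red (N : ℕ) (a : ℤ) : ℤ :=
  if 2 * (a % (N : ℤ)) ≤ (N : ℤ) then a % (N : ℤ) else (N : ℤ) - a % (N : ℤ)

/-- `μ(a) ∈ {±1}` with `a ≡ μ(a){a} mod N`. -/
def muSign (N : ℕ) (a : ℤ) : ℤ :=
  if 2 * (a % (N : ℤ)) ≤ (N : ℤ) then 1 else -1

/-- `φ_s(τ) = (2πi)⁻²℘(s/N; L_τ) − 1/12`. -/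
noncomputable def phiFun (N : ℕ) (s : ℤ) (τ : ℂ) : ℂ :=
  (1 / (2 * (Real.pi : ℂ) * Complex.I) ^ 2) * wp τ ((s : ℂ) / N) - 1 / 12

/-- `f[A]₂` : weight-2 slash of `φ_s`. -/
noncomputable def phiSlash (N : ℕ) (s : ℤ) (A : Matrix (Fin 2) (Fin 2) ℤ) (τ : ℂ) : ℂ :=
  phiFun N s (moebius A τ) * ((A 1 0 : ℂ) * τ + (A 1 1 : ℂ)) ^ (-2 : ℤ)

/-- `q = e^{2πiτ/N}`. -/
noncomputable def qq (N : ℕ) (τ : ℂ) : ℂ :=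
  Complex.exp (2 * (Real.pi : ℂ) * Complex.I * τ / N)

/-- `ζ = e^{2πi/N}`. -/
noncomputable def zetaN (N : ℕ) : ℂ :=
  Complex.exp (2 * (Real.pi : ℂ) * Complex.I / N)

/-- `θ_{a,b} = ζ^a(1−ζ^{b−a})(1−ζ^{b+a})/((1−ζ^a)²(1−ζ^b)²)`. -/
noncomputable def theta (ζ : ℂ) (a b : ℤ) : ℂ :=
  ζ ^ a * (1 - ζ ^ (b - a)) * (1 - ζ ^ (b + a)) / ((1 - ζ ^ a) ^ 2 * (1 - ζ ^ b) ^ 2)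

noncomputable section

open Metric

/-- The `n`-th Taylor coefficient of `g` at the origin. -/
def taylorCoeff (g : ℂ → ℂ) (n : ℕ) : ℂ := iteratedDeriv n g 0 / n.factorial

/-- Holomorphic functions on the unit disc whose Taylor coefficients are algebraic integers. -/
structure IntegralSeries (g : ℂ → ℂ) : Prop where
  differentiableOn : DifferentiableOn ℂ g (ball 0 1)
  isIntegral : ∀ n, IsIntegral ℤ (taylorCoeff g n)

lemma ball_zero_one_mem_nhds : ball (0 : ℂ) 1 ∈ nhds (0 : ℂ) := ball_mem_nhds _ one_pos

lemma taylorCoeff_zero (g : ℂ → ℂ) : taylorCoeff g 0 = g 0 := by simp [taylorCoeff]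

lemma hasSum_taylorCoeff {g : ℂ → ℂ} (hg : DifferentiableOn ℂ g (ball 0 1)) {q : ℂ}
    (hq : ‖q‖ < 1) : HasSum (fun n => taylorCoeff g n * q ^ n) (g q) := by
  have := Complex.hasSum_taylorSeries_on_ball hg (z := q) (by simpa using hq)
  refine this.congr_fun ?_ |> fun h => h
  intro n
  simp [taylorCoeff, div_eq_mul_inv]
  ring

lemma hasFPowerSeriesOnBall_of_hasSum {g : ℂ → ℂ} {a : ℕ → ℂ}
    (h : ∀ q : ℂ, ‖q‖ < 1 → HasSum (fun n => a n * q ^ n) (g q)) :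
    HasFPowerSeriesOnBall g (FormalMultilinearSeries.ofScalars ℂ a) 0 1 where
  r_le := by
    refine ENNReal.le_of_forall_nnreal_lt fun r hr => ?_
    apply FormalMultilinearSeries.le_radius_of_summable
    have hr' : ‖((r : ℝ) : ℂ)‖ < 1 := by simpa using hr
    have := (h _ hr').summable.norm
    refine this.congr fun n => ?_
    rw [FormalMultilinearSeries.ofScalars_norm]
    simp
  r_pos := one_pos
  hasSum := by
    intro y hy
    rw [← ENNReal.ofReal_one, Metric.eball_ofReal] at hy
    have hy' : ‖y‖ < 1 := by simpa using hy
    have := h y hy'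
    rw [zero_add]
    convert! this using 2 with n
    simp [mul_comm]

lemma differentiableOn_of_hasSum {g : ℂ → ℂ} {a : ℕ → ℂ}
    (h : ∀ q : ℂ, ‖q‖ < 1 → HasSum (fun n => a n * q ^ n) (g q)) :
    DifferentiableOn ℂ g (ball 0 1) := by
  have := (hasFPowerSeriesOnBall_of_hasSum h).differentiableOn
  rwa [← ENNReal.ofReal_one, Metric.eball_ofReal] at this

lemma taylorCoeff_of_hasSum {g : ℂ → ℂ} {a : ℕ → ℂ}
    (h : ∀ q : ℂ, ‖q‖ < 1 → HasSum (fun n => a n * q ^ n) (g q)) (n : ℕ) :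
    taylorCoeff g n = a n := by
  have h1 := (hasFPowerSeriesOnBall_of_hasSum h).hasFPowerSeriesAt
  have h2 := (hasFPowerSeriesOnBall_of_hasSum
    (fun q hq => hasSum_taylorCoeff (differentiableOn_of_hasSum h) hq)).hasFPowerSeriesAt
  have := h1.eq_formalMultilinearSeries h2
  have := congrArg (fun p => FormalMultilinearSeries.coeff p n) this
  simpa [FormalMultilinearSeries.coeff_ofScalars] using this.symm

lemma IntegralSeries.of_hasSum {g : ℂ → ℂ} {a : ℕ → ℂ} (ha : ∀ n, IsIntegral ℤ (a n))
    (h : ∀ q : ℂ, ‖q‖ < 1 → HasSum (fun n => a n * q ^ n) (g q)) : IntegralSeries g :=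
  ⟨differentiableOn_of_hasSum h, fun n => taylorCoeff_of_hasSum h n ▸ ha n⟩

lemma taylorCoeff_mul {f g : ℂ → ℂ} (hf : DifferentiableOn ℂ f (ball 0 1))
    (hg : DifferentiableOn ℂ g (ball 0 1)) (n : ℕ) :
    taylorCoeff (f * g) n =
      ∑ i ∈ Finset.range (n + 1), taylorCoeff f i * taylorCoeff g (n - i) := by
  have hf' : ContDiffAt ℂ n f 0 := (hf.analyticAt ball_zero_one_mem_nhds).contDiffAt
  have hg' : ContDiffAt ℂ n g 0 := (hg.analyticAt ball_zero_one_mem_nhds).contDiffAt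
  rw [taylorCoeff, iteratedDeriv_mul hf' hg', Finset.sum_div]
  refine Finset.sum_congr rfl fun i hi => ?_
  have hi : i ≤ n := Nat.lt_succ_iff.mp (Finset.mem_range.mp hi)
  have := Nat.choose_mul_factorial_mul_factorial hi
  have h1 : (n.choose i : ℂ) * i.factorial * (n - i).factorial = n.factorial := mod_cast this
  have hi0 : (i.factorial : ℂ) ≠ 0 := mod_cast i.factorial_ne_zero
  have hi1 : ((n - i).factorial : ℂ) ≠ 0 := mod_cast (n - i).factorial_ne_zero
  have hi2 : (n.factorial : ℂ) ≠ 0 := mod_cast n.factorial_ne_zero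
  rw [taylorCoeff, taylorCoeff]
  field_simp
  rw [← h1]
  ring

lemma taylorCoeff_congr {f g : ℂ → ℂ} (h : Set.EqOn f g (ball 0 1)) (n : ℕ) :
    taylorCoeff f n = taylorCoeff g n := by
  rw [taylorCoeff, taylorCoeff,
    (h.eventuallyEq_of_mem ball_zero_one_mem_nhds).iteratedDeriv_eq]

namespace IntegralSeries

variable {f g : ℂ → ℂ}

lemma congr (hf : IntegralSeries f) (h : Set.EqOn g f (ball 0 1)) : IntegralSeries g :=
  ⟨hf.differentiableOn.congr h, fun n => taylorCoeff_congr h n ▸ hf.isIntegral n⟩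

lemma hasSum (hf : IntegralSeries f) {q : ℂ} (hq : ‖q‖ < 1) :
    HasSum (fun n => taylorCoeff f n * q ^ n) (f q) :=
  hasSum_taylorCoeff hf.differentiableOn hq

lemma isIntegral_apply_zero (hf : IntegralSeries f) : IsIntegral ℤ (f 0) :=
  taylorCoeff_zero f ▸ hf.isIntegral 0

protected lemma mul (hf : IntegralSeries f) (hg : IntegralSeries g) : IntegralSeries (f * g) :=
  ⟨hf.differentiableOn.mul hg.differentiableOn, fun n => by
    rw [taylorCoeff_mul hf.differentiableOn hg.differentiableOn]
    exact IsIntegral.sum _ fun i _ => (hf.isIntegral i).mul (hg.isIntegral _)⟩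

protected lemma add (hf : IntegralSeries f) (hg : IntegralSeries g) : IntegralSeries (f + g) :=
  of_hasSum (fun n => (hf.isIntegral n).add (hg.isIntegral n)) fun q hq => by
    simpa [add_mul] using (hf.hasSum hq).add (hg.hasSum hq)

lemma const_mul_pow {c : ℂ} (hc : IsIntegral ℤ c) (m : ℕ) :
    IntegralSeries fun q => c * q ^ m := by
  refine of_hasSum (a := fun n => if n = m then c else 0) (fun n => ?_) fun q _ => ?_
  · split_ifs
    · exact hc
    · exact isIntegral_zero
  · convert! hasSum_ite_eq m (c * q ^ m) using 2 with n
    split_ifs with h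
    · rw [h]
    · simp

lemma const {c : ℂ} (hc : IsIntegral ℤ c) : IntegralSeries fun _ => c := by
  simpa using const_mul_pow hc 0

protected lemma neg (hf : IntegralSeries f) : IntegralSeries (-f) := by
  exact ((const isIntegral_one.neg).mul hf).congr fun q _ => by simp

protected lemma pow (hf : IntegralSeries f) (n : ℕ) : IntegralSeries (f ^ n) := by
  induction n with
  | zero => simpa using! const isIntegral_one
  | succ n ih => rw [pow_succ]; exact ih.mul hf

/-- Substitution of a monomial. -/
lemma comp_const_mul_pow (hf : IntegralSeries f) {η : ℂ} (hη : IsIntegral ℤ η) (hη1 : ‖η‖ ≤ 1)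
    {m : ℕ} (hm : 0 < m) : IntegralSeries fun q => f (η * q ^ m) := by
  have hinj : Function.Injective fun n : ℕ => m * n := fun a b h => Nat.eq_of_mul_eq_mul_left hm h
  refine of_hasSum (a := Function.extend (fun n : ℕ => m * n)
    (fun n => taylorCoeff f n * η ^ n) 0) (fun n => ?_) fun q hq => ?_
  · by_cases h : ∃ k, m * k = n
    · obtain ⟨k, rfl⟩ := h
      rw [hinj.extend_apply (f := fun n : ℕ => m * n)]
      exact (hf.isIntegral k).mul (hη.pow k)
    · rw [Function.extend_apply' _ _ _ h]
      exact isIntegral_zero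
  · have hq' : ‖η * q ^ m‖ < 1 := by
      rw [norm_mul, norm_pow]
      calc ‖η‖ * ‖q‖ ^ m ≤ 1 * ‖q‖ ^ m := by gcongr
        _ < 1 := by simpa using pow_lt_one₀ (norm_nonneg _) hq hm.ne'
    have := hf.hasSum hq'
    rw [← hinj.hasSum_iff]
    · convert! this using 2 with n
      simp only [Function.comp_apply]
      rw [hinj.extend_apply (f := fun n : ℕ => m * n)]
      ring
    · intro n hn
      rw [Function.extend_apply' _ _ _ (by simpa using hn)]
      simp

lemma inv (hf : IntegralSeries f) (h0 : ∀ q, ‖q‖ < 1 → f q ≠ 0) (h1 : IsIntegral ℤ (f 0)⁻¹) :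
    IntegralSeries f⁻¹ := by
  have hd : DifferentiableOn ℂ f⁻¹ (ball 0 1) :=
    hf.differentiableOn.inv fun q hq => h0 q (by simpa using hq)
  refine ⟨hd, fun n => ?_⟩
  induction n using Nat.strong_induction_on with
  | _ n ih =>
    rcases Nat.eq_zero_or_pos n with rfl | hn
    · simpa [taylorCoeff_zero] using h1
    have hmul : taylorCoeff (f * f⁻¹) n = 0 := by
      rw [taylorCoeff_congr (f := f * f⁻¹) (g := fun _ => 1)
        fun q hq => mul_inv_cancel₀ (h0 q (by simpa using hq))]
      simp [taylorCoeff, iteratedDeriv_const, hn.ne']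
    rw [taylorCoeff_mul hf.differentiableOn hd, Finset.sum_range_succ', taylorCoeff_zero] at hmul
    have hf0 : f 0 ≠ 0 := h0 0 (by simp)
    have : taylorCoeff f⁻¹ n = -((f 0)⁻¹ *
        ∑ i ∈ Finset.range n, taylorCoeff f (i + 1) * taylorCoeff f⁻¹ (n - (i + 1))) := by
      rw [eq_neg_iff_add_eq_zero]
      rw [Nat.sub_zero] at hmul
      field_simp
      linear_combination hmul
    rw [this]
    exact (h1.mul (IsIntegral.sum _ fun i hi => (hf.isIntegral _).mul
      (ih _ (by have := Finset.mem_range.mp hi; omega)))).neg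

/-- A series without constant term is divisible by the variable. -/
lemma exists_eq_mul (hf : IntegralSeries f) (h0 : f 0 = 0) :
    ∃ g, IntegralSeries g ∧ ∀ q, f q = q * g q := by
  have hmul : ∀ q, f q = q * dslope f 0 q := fun q => by
    simpa [h0] using (sub_smul_dslope f 0 q).symm
  have hd : DifferentiableOn ℂ (dslope f 0) (ball 0 1) :=
    (differentiableOn_dslope ball_zero_one_mem_nhds).mpr hf.differentiableOn
  refine ⟨dslope f 0, ⟨hd, fun n => ?_⟩, hmul⟩
  have h1 := hf.isIntegral (n + 1)
  have hid : IntegralSeries fun q => q := by simpa using const_mul_pow isIntegral_one 1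
  have hc : ∀ i, taylorCoeff (fun q => q) i = if i = 1 then 1 else 0 :=
    taylorCoeff_of_hasSum fun q _ => by
      convert! hasSum_ite_eq 1 q using 2 with n
      split_ifs with h <;> simp [h]
  rw [taylorCoeff_congr (g := (fun q => q) * dslope f 0) fun q _ => hmul q,
    taylorCoeff_mul hid.differentiableOn hd] at h1
  simpa [hc] using h1

/-- Locally uniform limits with eventually constant Taylor coefficients. -/
lemma of_tendsto {F : ℕ → ℂ → ℂ} (hF : ∀ m, IntegralSeries (F m))
    (h : TendstoLocallyUniformlyOn F f Filter.atTop (ball 0 1))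
    (hc : ∀ n, ∃ c, ∀ᶠ m in Filter.atTop, taylorCoeff (F m) n = c) : IntegralSeries f := by
  refine ⟨h.differentiableOn (.of_forall fun m => (hF m).differentiableOn) isOpen_ball,
    fun n => ?_⟩
  obtain ⟨c, hc⟩ := hc n
  have key : ∀ k, TendstoLocallyUniformlyOn (fun m => iteratedDeriv k (F m)) (iteratedDeriv k f)
      Filter.atTop (ball 0 1) ∧ ∀ m, DifferentiableOn ℂ (iteratedDeriv k (F m)) (ball 0 1) := by
    intro k
    induction k with
    | zero => simpa using ⟨h, fun m => (hF m).differentiableOn⟩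
    | succ k ih =>
      simp only [iteratedDeriv_succ]
      exact ⟨ih.1.deriv (.of_forall ih.2) isOpen_ball, fun m => (ih.2 m).deriv isOpen_ball⟩
  have ht := ((key n).1.tendsto_at (mem_ball_self one_pos)).div_const (n.factorial : ℂ)
  have hcc : Filter.Tendsto (fun m => taylorCoeff (F m) n) Filter.atTop (nhds c) :=
    tendsto_const_nhds.congr' (hc.mono fun m hm => hm.symm)
  have : taylorCoeff f n = c := tendsto_nhds_unique ht hcc
  obtain ⟨m, hm⟩ := hc.exists
  rw [this, ← hm]
  exact (hF m).isIntegral n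

end IntegralSeries

/-- The infinite product `∏ (1 - q ^ n * u)` over `n ≥ 0`. -/
def poch (q u : ℂ) : ℂ := ∏' n : ℕ, (1 - q ^ n * u)

lemma summable_norm_poch {q : ℂ} (hq : ‖q‖ < 1) (u : ℂ) :
    Summable fun n : ℕ => ‖-(q ^ n * u)‖ := by
  simpa using (summable_geometric_of_lt_one (norm_nonneg q) hq).mul_right ‖u‖

lemma multipliable_poch {q : ℂ} (hq : ‖q‖ < 1) (u : ℂ) :
    Multipliable fun n : ℕ => 1 - q ^ n * u := by
  simp only [sub_eq_add_neg]
  exact multipliable_one_add_of_summable (f := fun n : ℕ => -(q ^ n * u)) (summable_norm_poch hq u)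

lemma poch_eq_mul {q : ℂ} (hq : ‖q‖ < 1) (u : ℂ) :
    poch q u = (1 - u) * poch q (q * u) := by
  have h := multipliable_poch hq (q * u)
  have he : (fun n : ℕ => 1 - q ^ n * (q * u)) = fun n => 1 - q ^ (n + 1) * u := by
    ext n; ring
  rw [he] at h
  have h1 := tprod_eq_zero_mul' (f := fun n : ℕ => 1 - q ^ n * u) h
  rw [poch, poch, he, h1]
  simp

lemma poch_ne_zero {q : ℂ} (hq : ‖q‖ < 1) {u : ℂ} (h : ∀ n : ℕ, q ^ n * u ≠ 1) :
    poch q u ≠ 0 := by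
  have := tprod_one_add_ne_zero_of_summable (f := fun n : ℕ => -(q ^ n * u))
    (fun n => by simpa [← sub_eq_add_neg, sub_eq_zero] using (h n).symm) (summable_norm_poch hq u)
  simpa [← sub_eq_add_neg] using! this

lemma hasProdLocallyUniformlyOn_poch {a b : ℂ → ℂ} {U : Set ℂ} (hU : IsOpen U)
    (ha : ContinuousOn a U) (hb : ContinuousOn b U) (h : ∀ x ∈ U, ‖a x‖ < 1) :
    HasProdLocallyUniformlyOn (fun (n : ℕ) x => 1 - a x ^ n * b x)
      (fun x => poch (a x) (b x)) U := by
  simp_rw [poch, sub_eq_add_neg]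
  apply hasProdLocallyUniformlyOn_of_forall_compact hU
  intro K hK hcK
  rcases K.eq_empty_or_nonempty with hN | hN
  · simpa [hasProdUniformlyOn_iff_tendstoUniformlyOn, hN] using tendstoUniformlyOn_empty
  · obtain ⟨x₀, hx₀, ha₀⟩ := hcK.exists_isMaxOn hN (ha.mono hK).norm
    obtain ⟨x₁, hx₁, hb₁⟩ := hcK.exists_isMaxOn hN (hb.mono hK).norm
    refine ((summable_geometric_of_lt_one (norm_nonneg (a x₀)) (h _ (hK hx₀))).mul_right
      ‖b x₁‖).hasProdUniformlyOn_nat_one_add hcK (.of_forall fun n x hx => ?_)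
      (fun n => (((ha.mono hK).pow n).mul (hb.mono hK)).neg)
    rw [norm_neg, norm_mul, norm_pow]
    gcongr
    · exact ha₀ hx
    · exact hb₁ hx

lemma differentiableOn_poch {a b : ℂ → ℂ} {U : Set ℂ} (hU : IsOpen U)
    (ha : DifferentiableOn ℂ a U) (hb : DifferentiableOn ℂ b U) (h : ∀ x ∈ U, ‖a x‖ < 1) :
    DifferentiableOn ℂ (fun x => poch (a x) (b x)) U :=
  (hasProdLocallyUniformlyOn_poch hU ha.continuousOn hb.continuousOn h).differentiableOn
    (.of_forall fun _ => by
      simpa [Finset.prod_fn] using DifferentiableOn.finsetProd (fun _ _ => by fun_prop)) hU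

lemma taylorCoeff_mul_const_mul_pow {f : ℂ → ℂ} (hf : DifferentiableOn ℂ f (ball 0 1)) (c : ℂ)
    {m n : ℕ} (h : n < m) : taylorCoeff (fun q => f q * (c * q ^ m)) n = 0 := by
  have hd : DifferentiableOn ℂ (fun q : ℂ => c * q ^ m) (ball 0 1) := by fun_prop
  have hc : ∀ i, taylorCoeff (fun q => c * q ^ m) i = if i = m then c else 0 :=
    taylorCoeff_of_hasSum fun q _ => by
      convert! hasSum_ite_eq m (c * q ^ m) using 2 with n
      split_ifs with h <;> simp [h]
  have := taylorCoeff_mul hf hd n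
  rw [show (f * fun q => c * q ^ m) = fun q => f q * (c * q ^ m) from rfl] at this
  rw [this]
  refine Finset.sum_eq_zero fun i hi => ?_
  rw [hc, if_neg (by omega), mul_zero]

lemma IntegralSeries.poch {N r : ℕ} (hN : 0 < N) (hr : 0 < r) {η : ℂ} (hη : IsIntegral ℤ η) :
    IntegralSeries fun Q => poch (Q ^ N) (η * Q ^ r) := by
  have hlim := (hasProdLocallyUniformlyOn_poch (a := fun Q => Q ^ N) (b := fun Q => η * Q ^ r)
    isOpen_ball (by fun_prop) (by fun_prop) (U := ball 0 1) fun x hx => by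
      rw [norm_pow]
      exact pow_lt_one₀ (norm_nonneg _) (by simpa using hx) hN.ne').tendstoLocallyUniformlyOn_finsetRange
  have hF : ∀ m, IntegralSeries fun Q => ∏ n ∈ Finset.range m, (1 - (Q ^ N) ^ n * (η * Q ^ r)) := by
    intro m
    induction m with
    | zero => simpa using const isIntegral_one
    | succ m ih =>
      refine (ih.mul ((const isIntegral_one).add (const_mul_pow hη.neg (N * m + r)))).congr
        fun Q _ => ?_
      simp only [Finset.prod_range_succ, Pi.mul_apply, Pi.add_apply]
      ring
  refine of_tendsto hF hlim fun n => ⟨taylorCoeff (fun Q => ∏ k ∈ Finset.range n,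
    (1 - (Q ^ N) ^ k * (η * Q ^ r))) n, ?_⟩
  filter_upwards [Filter.eventually_ge_atTop n] with m hm
  induction m, hm using Nat.le_induction with
  | base => rfl
  | succ m hm ih =>
    rw [← ih]
    have h1 := taylorCoeff_mul_const_mul_pow (hF m).differentiableOn (-η)
      (show n < N * m + r by nlinarith)
    have hs : IntegralSeries (fun Q => (∏ n ∈ Finset.range m, (1 - (Q ^ N) ^ n * (η * Q ^ r))) *
      (-η * Q ^ (N * m + r))) := (hF m).mul (const_mul_pow hη.neg (N * m + r))
    have : taylorCoeff (fun Q => ∏ n ∈ Finset.range (m + 1), (1 - (Q ^ N) ^ n * (η * Q ^ r))) n =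
      taylorCoeff (fun Q => ∏ n ∈ Finset.range m, (1 - (Q ^ N) ^ n * (η * Q ^ r))) n +
      taylorCoeff (fun Q => (∏ n ∈ Finset.range m, (1 - (Q ^ N) ^ n * (η * Q ^ r))) *
        (-η * Q ^ (N * m + r))) n := by
      refine taylorCoeff_of_hasSum (a := fun n =>
        taylorCoeff (fun Q => ∏ n ∈ Finset.range m, (1 - (Q ^ N) ^ n * (η * Q ^ r))) n +
      taylorCoeff (fun Q => (∏ n ∈ Finset.range m, (1 - (Q ^ N) ^ n * (η * Q ^ r))) *
        (-η * Q ^ (N * m + r))) n) (fun q hq => ?_) n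
      convert! ((hF m).hasSum hq).add (hs.hasSum hq) using 1
      · ext; ring
      · rw [Finset.prod_range_succ]; ring
    rw [this, h1, add_zero]

lemma poch_monomial_ne_zero {N r : ℕ} (hN : 0 < N) (hr : 0 < r) {η Q : ℂ} (hη : ‖η‖ ≤ 1)
    (hQ : ‖Q‖ < 1) : poch (Q ^ N) (η * Q ^ r) ≠ 0 := by
  have hQN : ‖Q ^ N‖ < 1 := by rw [norm_pow]; exact pow_lt_one₀ (norm_nonneg _) hQ hN.ne'
  refine poch_ne_zero hQN fun n h => ?_
  have : ‖(Q ^ N) ^ n * (η * Q ^ r)‖ < 1 := by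
    rw [norm_mul, norm_mul, norm_pow _ n, norm_pow Q r]
    calc _ ≤ 1 * (1 * ‖Q‖ ^ r) := by gcongr; exact pow_le_one₀ (norm_nonneg _) hQN.le
      _ < 1 := by simpa using pow_lt_one₀ (norm_nonneg _) hQ hr.ne'
  rw [h] at this
  simp at this

lemma poch_zero_right (q : ℂ) : poch q 0 = 1 := by simp [poch]

/-- The exponential `e(z) = exp (2πiz)`. -/
def ee (z : ℂ) : ℂ := exp (2 * Real.pi * I * z)

lemma ee_add (z w : ℂ) : ee (z + w) = ee z * ee w := by
  rw [ee, ee, ee, ← Complex.exp_add]; ring_nf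

lemma ee_ne_zero (z : ℂ) : ee z ≠ 0 := Complex.exp_ne_zero _

lemma ee_neg (z : ℂ) : ee (-z) = (ee z)⁻¹ := by
  rw [ee, ee, ← Complex.exp_neg]; ring_nf

lemma ee_zero : ee 0 = 1 := by simp [ee]

lemma ee_int (n : ℤ) : ee n = 1 := by
  rw [ee, mul_comm]; exact Complex.exp_int_mul_two_pi_mul_I n

lemma ee_nat_mul (n : ℕ) (z : ℂ) : ee (n * z) = ee z ^ n := by
  rw [ee, ee, ← Complex.exp_nat_mul]; ring_nf

lemma ee_int_mul (n : ℤ) (z : ℂ) : ee (n * z) = ee z ^ n := by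
  rw [ee, ee, ← Complex.exp_int_mul]; ring_nf

lemma ee_eq_one_iff {z : ℂ} : ee z = 1 ↔ ∃ n : ℤ, z = n := by
  rw [ee, Complex.exp_eq_one_iff]
  refine exists_congr fun n => ⟨fun h => ?_, fun h => by rw [h]; ring⟩
  have : (2 * Real.pi * I : ℂ) ≠ 0 := Complex.two_pi_I_ne_zero
  exact mul_left_cancel₀ this (by rw [h]; ring)

lemma norm_ee (z : ℂ) : ‖ee z‖ = Real.exp (-(2 * Real.pi * z.im)) := by
  rw [ee, Complex.norm_exp]; simp

lemma norm_ee_lt_one {τ : ℂ} (h : 0 < τ.im) : ‖ee τ‖ < 1 := by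
  rw [norm_ee, Real.exp_lt_one_iff]
  have := Real.pi_pos
  nlinarith [mul_pos this h]

lemma hasDerivAt_ee (z : ℂ) : HasDerivAt ee (2 * Real.pi * I * ee z) z := by
  have h : HasDerivAt (fun z : ℂ => 2 * Real.pi * I * z) (2 * Real.pi * I) z := by
    simpa using (hasDerivAt_id z).const_mul (2 * Real.pi * I : ℂ)
  have := h.cexp
  rwa [mul_comm (cexp _)] at this

lemma differentiable_ee : Differentiable ℂ ee := fun z => (hasDerivAt_ee z).differentiableAt

/-- The period pair `(1, τ)`. -/
def onePair {τ : ℂ} (h : 0 < τ.im) : PeriodPair where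
  ω₁ := 1
  ω₂ := τ
  indep := by
    rw [LinearIndependent.pair_iff]
    intro s t hst
    have h1 := congrArg Complex.im hst
    have h2 := congrArg Complex.re hst
    simp at h1 h2
    have : t = 0 := h1.resolve_right h.ne'
    simp_all

lemma mem_onePair {τ : ℂ} (h : 0 < τ.im) {z : ℂ} :
    z ∈ (onePair h).lattice ↔ ∃ m n : ℤ, (m : ℂ) + n * τ = z := by
  rw [PeriodPair.mem_lattice]; simp [onePair]

lemma wp_eq_weierstrassP {τ : ℂ} (h : 0 < τ.im) (z : ℂ) :
    wp τ z = PeriodPair.weierstrassP (onePair h) z := by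
  rw [← PeriodPair.weierstrassPExcept_add (onePair h) 0 z, add_comm, wp]
  congr 1
  · simp
  · rw [PeriodPair.weierstrassPExcept, ← (onePair h).latticeEquivProd.symm.toEquiv.tsum_eq]
    refine (tsum_subtype {p : ℤ × ℤ | p ≠ 0} (fun p : ℤ × ℤ =>
      (1 / (z - ((p.1 : ℂ) + (p.2 : ℂ) * τ)) ^ 2 - 1 / ((p.1 : ℂ) + (p.2 : ℂ) * τ) ^ 2))).trans
      (tsum_congr fun p => ?_)
    have hval : (((onePair h).latticeEquivProd.symm p : (onePair h).lattice) : ℂ) =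
        p.1 + p.2 * τ := by
      rw [PeriodPair.latticeEquiv_symm_apply]; simp [onePair]
    rw [Set.indicator_apply]
    by_cases hp : p = 0
    · simp [hp]
    · have : (((onePair h).latticeEquivProd.symm p : (onePair h).lattice) : ℂ) ≠ 0 := by
        simpa using hp
      rw [if_pos (by simpa using hp)]
      rw [if_neg (by simpa using hp)]
      rw [← hval]
      rfl

/-- The theta product with simple zeros at `ℤ + ℤτ`. -/
def thetaProd (τ z : ℂ) : ℂ := poch (ee τ) (ee z) * poch (ee τ) (ee τ * ee (-z))

lemma thetaProd_add_one (τ z : ℂ) : thetaProd τ (z + 1) = thetaProd τ z := by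
  have h1 : ee 1 = 1 := by simpa using ee_int 1
  simp [thetaProd, ee_add, ee_neg, h1]

lemma thetaProd_neg {τ : ℂ} (h : 0 < τ.im) (z : ℂ) :
    thetaProd τ (-z) = -ee (-z) * thetaProd τ z := by
  have hq := norm_ee_lt_one h
  rw [thetaProd, thetaProd, neg_neg, poch_eq_mul hq (ee (-z)), poch_eq_mul hq (ee z), ee_neg]
  have := ee_ne_zero z
  field_simp
  ring

lemma thetaProd_add_tau {τ : ℂ} (h : 0 < τ.im) (z : ℂ) :
    thetaProd τ (z + τ) = -ee (-z) * thetaProd τ z := by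
  rw [← thetaProd_neg h, thetaProd, thetaProd, neg_neg, neg_add, ee_add, ee_add, ee_neg τ]
  have := ee_ne_zero τ
  rw [mul_left_comm, mul_inv_cancel₀ this, mul_one, mul_comm (ee z), mul_comm (poch _ _)]

lemma thetaProd_zero (τ : ℂ) (h : 0 < τ.im) : thetaProd τ 0 = 0 := by
  rw [thetaProd, ee_zero, poch_eq_mul (norm_ee_lt_one h)]; simp

lemma thetaProd_ne_zero {τ : ℂ} (h : 0 < τ.im) {z : ℂ} (hz : z ∉ (onePair h).lattice) :
    thetaProd τ z ≠ 0 := by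
  have hq := norm_ee_lt_one h
  rw [mem_onePair] at hz
  refine mul_ne_zero (poch_ne_zero hq fun n hn => hz ?_) (poch_ne_zero hq fun n hn => hz ?_)
  · rw [← ee_nat_mul, ← ee_add, ee_eq_one_iff] at hn
    obtain ⟨m, hm⟩ := hn
    exact ⟨m, -n, by push_cast; linear_combination -hm⟩
  · rw [← ee_nat_mul, ← ee_add, ← ee_add, ee_eq_one_iff] at hn
    obtain ⟨m, hm⟩ := hn
    exact ⟨-m, n + 1, by push_cast; linear_combination hm⟩

lemma differentiable_thetaProd {τ : ℂ} (h : 0 < τ.im) : Differentiable ℂ (thetaProd τ) := by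
  have hq := norm_ee_lt_one h
  rw [← differentiableOn_univ]
  refine DifferentiableOn.mul (differentiableOn_poch isOpen_univ (by fun_prop)
    differentiable_ee.differentiableOn fun _ _ => hq)
    (differentiableOn_poch isOpen_univ (by fun_prop) ?_ fun _ _ => hq)
  exact ((differentiable_ee.comp differentiable_neg).const_mul _).differentiableOn

lemma deriv_thetaProd_zero {τ : ℂ} (h : 0 < τ.im) : deriv (thetaProd τ) 0 ≠ 0 := by
  have hq := norm_ee_lt_one h
  have hf : thetaProd τ = fun z => (1 - ee z) *
      (poch (ee τ) (ee τ * ee z) * poch (ee τ) (ee τ * ee (-z))) := by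
    ext z; rw [thetaProd, poch_eq_mul hq (ee z)]; ring
  have hP : Differentiable ℂ fun z =>
      poch (ee τ) (ee τ * ee z) * poch (ee τ) (ee τ * ee (-z)) := by
    rw [← differentiableOn_univ]
    refine DifferentiableOn.mul (differentiableOn_poch isOpen_univ (by fun_prop)
      (differentiable_ee.const_mul _).differentiableOn fun _ _ => hq)
      (differentiableOn_poch isOpen_univ (by fun_prop) ?_ fun _ _ => hq)
    exact ((differentiable_ee.comp differentiable_neg).const_mul _).differentiableOn
  have := (((hasDerivAt_ee 0).const_sub 1).mul (hP 0).hasDerivAt).deriv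
  have hne : poch (ee τ) (ee τ) ≠ 0 := poch_ne_zero hq fun n hn => by
    have h1 : ‖ee τ ^ n * ee τ‖ < 1 := by
      rw [← pow_succ, norm_pow]; exact pow_lt_one₀ (norm_nonneg _) hq n.succ_ne_zero
    rw [hn] at h1; simp at h1
  rw [hf]
  rw [show (fun z => (1 - ee z) * (poch (ee τ) (ee τ * ee z) * poch (ee τ) (ee τ * ee (-z)))) =
    (fun z => 1 - ee z) * (fun z => poch (ee τ) (ee τ * ee z) * poch (ee τ) (ee τ * ee (-z)))
    from rfl, this]
  simp [ee_zero, hne, Complex.I_ne_zero, Real.pi_ne_zero]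

end

noncomputable section

open Metric Topology

/-- A function holomorphic off a lattice, periodic, and `o(1/z)` at the origin is constant. -/
lemma PeriodPair.apply_eq_apply_of_isLittleO (L : PeriodPair) {f : ℂ → ℂ}
    (hd : DifferentiableOn ℂ f (L.lattice : Set ℂ)ᶜ)
    (hp : ∀ z, ∀ w ∈ L.lattice, f (z + w) = f z)
    (ho : f =o[𝓝[≠] 0] fun z => z⁻¹) {z w : ℂ} (hz : z ∉ L.lattice) (hw : w ∉ L.lattice) :
    f z = f w := by
  classical
  set U : Set ℂ := ((L.lattice : Set ℂ) \ {0})ᶜ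
  have hU : U ∈ 𝓝 (0 : ℂ) := L.compl_lattice_sdiff_singleton_mem_nhds 0
  set c := Filter.limUnder (𝓝[≠] 0) f
  have h1 : DifferentiableOn ℂ (Function.update f 0 c) U := by
    refine Complex.differentiableOn_update_limUnder_of_isLittleO hU
      (hd.mono fun x hx => ?_) ?_
    · intro hxL; exact hx.1 ⟨hxL, hx.2⟩
    · simp only [sub_zero]
      refine ho.sub ?_
      rw [Asymptotics.isLittleO_const_left]
      right
      exact tendsto_norm_cobounded_atTop.comp (Filter.tendsto_inv₀_nhdsNE_zero)
  set H : ℂ → ℂ := fun x => if x ∈ L.lattice then c else f x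
  have hHp : ∀ z, ∀ w ∈ L.lattice, H (z + w) = H z := by
    intro z w hw
    simp only [H, hp z w hw, Submodule.add_mem_iff_left _ hw]
  have h0 : DifferentiableAt ℂ H 0 := by
    refine (h1.differentiableAt hU).congr_of_eventuallyEq ?_
    filter_upwards [hU] with x hx
    by_cases hx0 : x = 0
    · simp [hx0, H]
    · rw [Function.update_of_ne hx0]
      exact if_neg fun hxL => hx ⟨hxL, hx0⟩
  have hH : Differentiable ℂ H := by
    intro x
    by_cases hx : x ∈ L.lattice
    · have : H = H ∘ fun y => y - x := by
        ext y
        simpa using (hHp (y - x) x hx)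
      rw [this]
      refine DifferentiableAt.comp x ?_ (by fun_prop)
      simpa using h0
    · have hn : (L.lattice : Set ℂ)ᶜ ∈ 𝓝 x := L.isClosed_lattice.isOpen_compl.mem_nhds hx
      refine (hd.differentiableAt hn).congr_of_eventuallyEq ?_
      filter_upwards [hn] with y hy
      exact if_neg hy
  have := hH.apply_eq_apply_of_bounded
    (IsZLattice.isCompact_range_of_periodic L.lattice _ hH.continuous hHp).isBounded z w
  simpa [H, hz, hw] using this

lemma hasDerivAt_zero_of_even {f : ℂ → ℂ} (hf : DifferentiableAt ℂ f 0)
    (he : ∀ᶠ z in 𝓝 0, f (-z) = f z) : HasDerivAt f 0 0 := by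
  have h1 := hf.hasDerivAt
  have h2 : HasDerivAt (fun z => f (-z)) (-deriv f 0) 0 := by
    have h3 : HasDerivAt f (deriv f 0) (-0) := by simpa using h1
    simpa [Function.comp_def] using h3.comp (0 : ℂ) (hasDerivAt_neg (0 : ℂ))
  have h3 := h1.unique (h2.congr_of_eventuallyEq (he.mono fun z hz => hz.symm))
  have h4 : deriv f 0 = 0 := by linear_combination h3 / 2
  rwa [h4] at h1

/-- The factorization of `℘(z) - ℘(w)`. -/
theorem thetaProd_mul_div_eq {τ : ℂ} (h : 0 < τ.im) {z w : ℂ} (hz : z ∉ (onePair h).lattice)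
    (hw : w ∉ (onePair h).lattice) :
    thetaProd τ (z + w) * thetaProd τ (z - w) / thetaProd τ z ^ 2 =
      thetaProd τ w * thetaProd τ (-w) / deriv (thetaProd τ) 0 ^ 2 * (wp τ z - wp τ w) := by
  set L := onePair h
  set F := thetaProd τ
  set A := F w * F (-w) / deriv F 0 ^ 2 with hA
  have hF := differentiable_thetaProd h
  set g : ℂ → ℂ := fun z => F (z + w) * F (z - w) / F z ^ 2
  have hg1 : g.Periodic 1 := fun x => by
    simp only [g, F]
    rw [show x + 1 + w = x + w + 1 by ring, show x + 1 - w = x - w + 1 by ring,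
      thetaProd_add_one, thetaProd_add_one, thetaProd_add_one]
  have hg2 : g.Periodic τ := fun x => by
    simp only [g, F]
    rw [show x + τ + w = x + w + τ by ring, show x + τ - w = x - w + τ by ring,
      thetaProd_add_tau h, thetaProd_add_tau h, thetaProd_add_tau h]
    have e1 : ee (-(x + w)) * ee (-(x - w)) = ee (-x) ^ 2 := by
      rw [← ee_add, sq, ← ee_add]; ring_nf
    have := ee_ne_zero (-x)
    rw [show -ee (-(x + w)) * thetaProd τ (x + w) * (-ee (-(x - w)) * thetaProd τ (x - w)) =
      (ee (-(x + w)) * ee (-(x - w))) * (thetaProd τ (x + w) * thetaProd τ (x - w)) by ring, e1,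
      mul_pow, neg_sq]
    exact mul_div_mul_left _ _ (pow_ne_zero 2 this)
  have hge : ∀ x, g (-x) = g x := fun x => by
    simp only [g, F]
    rw [show -x + w = -(x - w) by ring, show -x - w = -(x + w) by ring,
      thetaProd_neg h, thetaProd_neg h, thetaProd_neg h]
    have e1 : ee (-(x + w)) * ee (-(x - w)) = ee (-x) ^ 2 := by
      rw [← ee_add, sq, ← ee_add]; ring_nf
    have := ee_ne_zero (-x)
    rw [show -ee (-(x - w)) * thetaProd τ (x - w) * (-ee (-(x + w)) * thetaProd τ (x + w)) =
      (ee (-(x + w)) * ee (-(x - w))) * (thetaProd τ (x + w) * thetaProd τ (x - w)) by ring, e1,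
      mul_pow, neg_sq]
    exact mul_div_mul_left _ _ (pow_ne_zero 2 this)
  have hgL : ∀ x, ∀ l ∈ L.lattice, g (x + l) = g x := by
    intro x l hl
    obtain ⟨m, n, rfl⟩ := (mem_onePair h).mp hl
    have := ((hg1.int_mul m).add_period (hg2.int_mul n)) x
    simpa using this
  have hwP : ∀ x, wp τ x = L.weierstrassP x := wp_eq_weierstrassP h
  set f : ℂ → ℂ := fun x => A * L.weierstrassP x - g x
  have hfd : DifferentiableOn ℂ f (L.lattice : Set ℂ)ᶜ := by
    refine (L.differentiableOn_weierstrassP.const_mul A).sub ?_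
    refine DifferentiableOn.div (Differentiable.differentiableOn ?_)
      (hF.pow 2).differentiableOn fun x hx => pow_ne_zero 2 (thetaProd_ne_zero h hx)
    exact (hF.comp (differentiable_id.add_const w)).mul (hF.comp (differentiable_id.sub_const w))
  have hfp : ∀ x, ∀ l ∈ L.lattice, f (x + l) = f x := fun x l hl => by
    simp only [f, hgL x l hl, L.weierstrassP_add_coe x ⟨l, hl⟩]
  have hfe : ∀ x, f (-x) = f x := fun x => by
    simp only [f, hge, PeriodPair.weierstrassP_neg]
  have hfo : f =o[𝓝[≠] 0] fun x => x⁻¹ := by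
    set E := dslope F 0
    have hE : Differentiable ℂ E := by
      rw [← differentiableOn_univ]
      exact (differentiableOn_dslope Filter.univ_mem).mpr hF.differentiableOn
    have hE0 : E 0 = deriv F 0 := dslope_same F 0
    have hE0' : E 0 ≠ 0 := hE0 ▸ deriv_thetaProd_zero h
    have hFE : ∀ x, F x = x * E x := fun x => by
      simpa [F, thetaProd_zero τ h] using (sub_smul_dslope F 0 x).symm
    set φ : ℂ → ℂ := fun x => A * (1 + x ^ 2 * L.weierstrassPExcept 0 x) -
      F (x + w) * F (x - w) / E x ^ 2
    have hφf : ∀ x, x ≠ 0 → φ x = x ^ 2 * f x := fun x hx => by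
      have h1 := L.weierstrassPExcept_add 0 x
      simp only [ZeroMemClass.coe_zero, sub_zero] at h1
      simp only [φ, f, g, hFE x, ← h1]
      rcases eq_or_ne (E x) 0 with hEx | hEx
      · simp [hEx]; field_simp; ring
      · field_simp
        ring
    have hφ0 : φ 0 = 0 := by
      simp only [φ, hA, hE0]
      simp
    have hφd : DifferentiableAt ℂ φ 0 := by
      have hP := (L.analyticAt_weierstrassPExcept 0).differentiableAt
      refine DifferentiableAt.sub ?_ ?_
      · exact ((((differentiableAt_id (𝕜 := ℂ)).pow 2).mul hP).const_add 1).const_mul A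
      · exact DifferentiableAt.div (((hF.comp (differentiable_id.add_const w)).mul
          (hF.comp (differentiable_id.sub_const w))) 0) ((hE 0).pow 2) (pow_ne_zero 2 hE0')
    have hφe : ∀ᶠ x in 𝓝 0, φ (-x) = φ x := .of_forall fun x => by
      rcases eq_or_ne x 0 with rfl | hx
      · simp
      · rw [hφf x hx, hφf (-x) (neg_ne_zero.mpr hx), hfe]; ring
    have hφ' := hasDerivAt_zero_of_even hφd hφe
    have ho : φ =o[𝓝[≠] 0] fun x => x := by
      have := hφ'.isLittleO
      simp only [hφ0, sub_zero, smul_zero] at this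
      exact this.mono nhdsWithin_le_nhds
    have := ho.mul_isBigO (Asymptotics.isBigO_refl (fun x : ℂ => (x ^ 2)⁻¹) (𝓝[≠] 0))
    refine this.congr' ?_ ?_
    · filter_upwards [self_mem_nhdsWithin] with x hx
      have hx : x ≠ 0 := hx
      rw [hφf x hx]; field_simp
    · filter_upwards [self_mem_nhdsWithin] with x hx
      have hx : x ≠ 0 := hx
      field_simp
  have := L.apply_eq_apply_of_isLittleO hfd hfp hfo hz hw
  have hgw : g w = 0 := by simp [g, F, thetaProd_zero τ h]
  simp only [f, hgw] at this
  rw [hwP, hwP]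
  show g z = _
  linear_combination -this

theorem wp_sub_div_wp_sub {τ : ℂ} (h : 0 < τ.im) {z₁ z₂ z₃ : ℂ} (h1 : z₁ ∉ (onePair h).lattice)
    (h2 : z₂ ∉ (onePair h).lattice) (h3 : z₃ ∉ (onePair h).lattice) :
    (wp τ z₁ - wp τ z₃) / (wp τ z₂ - wp τ z₃) =
      (thetaProd τ (z₁ + z₃) * thetaProd τ (z₁ - z₃) / thetaProd τ z₁ ^ 2) /
      (thetaProd τ (z₂ + z₃) * thetaProd τ (z₂ - z₃) / thetaProd τ z₂ ^ 2) := by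
  have h3' : -z₃ ∉ (onePair h).lattice := by simpa using h3
  rw [thetaProd_mul_div_eq h h1 h3, thetaProd_mul_div_eq h h2 h3, mul_div_mul_left]
  exact div_ne_zero (mul_ne_zero (thetaProd_ne_zero h h3) (thetaProd_ne_zero h h3'))
    (pow_ne_zero 2 (deriv_thetaProd_zero h))

end

noncomputable section

open Metric Topology
open UpperHalfPlane hiding I

/-- The uniformiser `exp (2πiτ / h)` at the cusp of width `h`. -/
def Qp (h : ℕ) (τ : ℍ) : ℂ := ee ((τ : ℂ) / h)

lemma Qp_ne_zero (h : ℕ) (τ : ℍ) : Qp h τ ≠ 0 := ee_ne_zero _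

lemma norm_Qp (h : ℕ) (τ : ℍ) : ‖Qp h τ‖ = Real.exp (-(2 * Real.pi * τ.im / h)) := by
  rw [Qp, norm_ee]
  congr 1
  rw [← ofReal_natCast, div_ofReal_im]
  simp
  ring

lemma norm_Qp_lt_one {h : ℕ} (hh : 0 < h) (τ : ℍ) : ‖Qp h τ‖ < 1 := by
  have := τ.im_pos
  rw [norm_Qp, Real.exp_lt_one_iff]
  have : 0 < 2 * Real.pi * τ.im / h := by positivity
  linarith

lemma Qp_mem_ball {h : ℕ} (hh : 0 < h) (τ : ℍ) : Qp h τ ∈ ball (0 : ℂ) 1 := by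
  simpa using norm_Qp_lt_one hh τ

lemma Qp_pow_self {h : ℕ} (hh : 0 < h) (τ : ℍ) : Qp h τ ^ h = ee τ := by
  rw [Qp, ← ee_nat_mul]
  have : (h : ℂ) ≠ 0 := by exact_mod_cast hh.ne'
  congr 1; field_simp

lemma exists_Qp_eq {h : ℕ} (hh : 0 < h) {q : ℂ} (hq : q ≠ 0) (hq1 : ‖q‖ < 1) :
    ∃ τ : ℍ, Qp h τ = q := by
  have hh' : (0 : ℝ) < h := by exact_mod_cast hh
  refine ⟨⟨Function.Periodic.invQParam h q,
    Function.Periodic.im_invQParam_pos_of_norm_lt_one hh' hq1 hq⟩, ?_⟩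
  refine Eq.trans ?_ (Function.Periodic.qParam_right_inv hh'.ne' hq)
  rw [Qp, ee, Function.Periodic.qParam]
  congr 1
  simp
  ring

lemma Qp_T (h : ℕ) (τ : ℍ) : Qp h (ModularGroup.T • τ) = ee (1 / h) * Qp h τ := by
  rw [Qp, Qp, ← ee_add, UpperHalfPlane.modular_T_smul]
  congr 1
  simp
  ring

lemma apply_zero_eq_of_Qp {h : ℕ} (hh : 0 < h) {f g : ℂ → ℂ} (hf : ContinuousAt f 0)
    (hg : ContinuousAt g 0) (hfg : ∀ τ, f (Qp h τ) = g (Qp h τ)) : f 0 = g 0 := by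
  have hne : (𝓝[≠] (0 : ℂ)).NeBot := inferInstance
  refine tendsto_nhds_unique_of_eventuallyEq (l := 𝓝[≠] (0 : ℂ))
    (hf.tendsto.mono_left nhdsWithin_le_nhds) (hg.tendsto.mono_left nhdsWithin_le_nhds) ?_
  filter_upwards [self_mem_nhdsWithin, nhdsWithin_le_nhds ball_zero_one_mem_nhds] with q hq hq1
  obtain ⟨τ, rfl⟩ := exists_Qp_eq hh hq (by simpa using hq1)
  exact hfg τ

lemma IntegralSeries.continuousAt_zero {g : ℂ → ℂ} (hg : IntegralSeries g) : ContinuousAt g 0 :=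
  (hg.differentiableOn.differentiableAt ball_zero_one_mem_nhds).continuousAt

/-- The modular invariant `j`, normalised as `E₄³ / Δ`. -/
def jInv (τ : ℍ) : ℂ := ModularForm.E₄ τ ^ 3 / ModularForm.discriminant τ

lemma apply_smul_of_slashInvariant {F : Type*} [FunLike F ℍ ℂ] {k : ℤ}
    [SlashInvariantFormClass F 𝒮ℒ k] (f : F) (γ : SL(2, ℤ)) (τ : ℍ) :
    f (γ • τ) = denom γ τ ^ k * f τ := by
  have : SlashInvariantFormClass F (CongruenceSubgroup.Gamma 1) k :=
    CongruenceSubgroup.Gamma_one_coe_eq_SL ▸ ‹_›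
  exact SlashInvariantForm.slash_action_eqn_SL'' f (CongruenceSubgroup.mem_Gamma_one γ) τ

lemma E4_smul (γ : SL(2, ℤ)) (τ : ℍ) :
    ModularForm.E₄ (γ • τ) = denom γ τ ^ (4 : ℤ) * ModularForm.E₄ τ :=
  apply_smul_of_slashInvariant ModularForm.E₄ γ τ

lemma discriminant_smul (γ : SL(2, ℤ)) (τ : ℍ) : ModularForm.discriminant (γ • τ) =
    denom γ τ ^ (12 : ℤ) * ModularForm.discriminant τ :=
  apply_smul_of_slashInvariant CuspForm.discriminant γ τ

lemma jInv_smul (γ : SL(2, ℤ)) (τ : ℍ) : jInv (γ • τ) = jInv τ := by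
  have h1 := denom_ne_zero γ τ
  have h2 := ModularForm.discriminant_ne_zero τ
  rw [jInv, jInv, E4_smul, discriminant_smul]
  field_simp

lemma discriminant_eq_poch (τ : ℍ) :
    ModularForm.discriminant τ = ee τ * poch (ee τ) (ee τ) ^ 24 := by
  have h := norm_ee_lt_one τ.im_pos
  rw [ModularForm.discriminant_eq_q_prod, poch, ← (multipliable_poch h _).tprod_pow 24]
  simp only [ModularForm.eta_q, Function.Periodic.qParam, ee, pow_succ]
  simp

lemma exists_E4_eq : ∃ g : ℂ → ℂ, IntegralSeries g ∧ g 0 = 1 ∧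
    ∀ τ : ℍ, ModularForm.E₄ τ = g (ee τ) := by
  set a : ℕ → ℂ := fun n => if n = 0 then 1 else 240 * (ArithmeticFunction.sigma 3 n : ℂ) with ha
  have hs : ∀ q : ℂ, ‖q‖ < 1 → Summable fun n => a n * q ^ n := by
    intro q hq
    have h2 := summable_norm_pow_mul_geometric_of_norm_lt_one 4 hq
    refine (summable_nat_add_iff 1).1 (Summable.of_norm_bounded
      (((summable_nat_add_iff 1).2 h2).mul_left 240) fun n => ?_)
    have : (ArithmeticFunction.sigma 3 (n + 1) : ℝ) ≤ (n + 1 : ℕ) ^ 4 := by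
      exact_mod_cast ArithmeticFunction.sigma_le_pow_succ 3 (n + 1)
    simp only [ha, Nat.add_eq_zero_iff, one_ne_zero, and_false, if_false, norm_mul, norm_pow,
      Complex.norm_natCast, mul_assoc]
    norm_num only [Complex.norm_ofNat]
    gcongr
  refine ⟨fun q => ∑' n, a n * q ^ n, IntegralSeries.of_hasSum (a := a) ?_ ?_, ?_, ?_⟩
  · intro n
    simp only [ha]
    split_ifs
    · exact isIntegral_one
    · exact_mod_cast isIntegral_algebraMap (R := ℤ) (x := 240 * (ArithmeticFunction.sigma 3 n : ℤ))
  · exact fun q hq => (hs q hq).hasSum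
  · simp only
    rw [tsum_eq_single 0 (fun n hn => by simp [hn])]
    simp [ha]
  · intro τ
    have hq := norm_ee_lt_one τ.im_pos
    have h1 := EisensteinSeries.q_expansion_bernoulli (k := 4) (by norm_num) ⟨2, rfl⟩ τ
    simp only
    rw [(hs _ hq).tsum_eq_zero_add]
    refine h1.trans ?_
    have h4 : (bernoulli 4) = -1 / 30 := by
      rw [bernoulli_eq_bernoulli'_of_ne_one (by norm_num), bernoulli'_four]
    rw [h4]
    simp_rw [zpow_natCast]
    rw [tsum_pnat_eq_tsum_succ (f := fun n : ℕ ↦ (ArithmeticFunction.sigma (4 - 1) n : ℂ) *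
      cexp (2 * Real.pi * I * τ) ^ n)]
    simp only [ha, Nat.add_eq_zero_iff, one_ne_zero, and_false, if_false, mul_assoc, tsum_mul_left,
      ee]
    norm_num
    
lemma exists_jInv_eq : ∃ g : ℂ → ℂ, IntegralSeries g ∧ g 0 = 1 ∧
    ∀ τ : ℍ, jInv τ * ee τ = g (ee τ) := by
  obtain ⟨e, he, he0, h⟩ := exists_E4_eq
  have hp : IntegralSeries fun Q => poch (Q ^ 1) (1 * Q ^ 1) :=
    IntegralSeries.poch one_pos one_pos isIntegral_one
  have hne : ∀ q : ℂ, ‖q‖ < 1 → poch (q ^ 1) (1 * q ^ 1) ≠ 0 := fun q hq =>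
    poch_monomial_ne_zero one_pos one_pos (by simp) hq
  have hi := (hp.pow 24).inv (fun q hq => pow_ne_zero _ (hne q hq))
    (by simp [poch_zero_right, isIntegral_one])
  refine ⟨_, (he.pow 3).mul hi, by simp [he0, poch_zero_right], fun τ => ?_⟩
  have := hne _ (norm_ee_lt_one τ.im_pos)
  have h2 := ee_ne_zero τ
  simp only [pow_one, one_mul] at this
  simp [jInv, discriminant_eq_poch, h]
  field_simp

open Polynomial in
/-- The `q`-expansion principle for modular functions of level one. -/
lemma exists_polynomial_jInv {h : ℕ} (hh : 0 < h) (K : ℕ) : ∀ (f : ℍ → ℂ) (g : ℂ → ℂ),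
    (∀ (γ : SL(2, ℤ)) τ, f (γ • τ) = f τ) → IntegralSeries g →
    (∀ τ, f τ * Qp h τ ^ K = g (Qp h τ)) →
    ∃ P : ℂ[X], (∀ i, IsIntegral ℤ (P.coeff i)) ∧ (∀ i, K < h * i → P.coeff i = 0) ∧
      (g 0 ≠ 0 → ∃ d, h * d = K ∧ P.coeff d = g 0) ∧ ∀ τ, f τ = P.eval (jInv τ) := by
  induction K with
  | zero =>
    intro f g hf hg hfg
    simp only [pow_zero, mul_one] at hfg
    have hconst : Set.EqOn g (Function.const ℂ (g 0)) (ball 0 1) := by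
      refine Complex.eq_const_of_exists_le (r := Real.exp (-(Real.pi / h))) hg.differentiableOn
        (Real.exp_nonneg _) ?_ fun z hz => ?_
      · rw [Real.exp_lt_one_iff]
        have : 0 < Real.pi / h := by positivity
        linarith
      rcases eq_or_ne z 0 with rfl | hz0
      · exact ⟨0, by simpa using Real.exp_nonneg _, le_rfl⟩
      obtain ⟨τ, rfl⟩ := exists_Qp_eq hh hz0 (by simpa using hz)
      obtain ⟨γ, hγ⟩ := ModularGroup.exists_one_half_le_im_smul τ
      refine ⟨Qp h (γ • τ), ?_, by rw [← hfg, ← hfg, hf]⟩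
      rw [mem_closedBall_zero_iff, norm_Qp]
      gcongr
      nlinarith [Real.pi_pos]
    refine ⟨C (g 0), fun i => ?_, fun i hi => ?_, fun _ => ⟨0, by simp⟩, fun τ => ?_⟩
    · rw [coeff_C]
      split_ifs
      exacts [hg.isIntegral_apply_zero, isIntegral_zero]
    · rw [coeff_C, if_neg]
      rintro rfl
      simp at hi
    · rw [hfg, eval_C, hconst (Qp_mem_ball hh τ)]; rfl
  | succ K ih =>
    intro f g hf hg hfg
    by_cases h0 : g 0 = 0
    · obtain ⟨g', hg', hgg'⟩ := hg.exists_eq_mul h0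
      obtain ⟨P, hP1, hP2, -, hP4⟩ := ih f g' hf hg' fun τ => by
        have h1 := hfg τ
        rw [hgg', pow_succ'] at h1
        exact mul_left_cancel₀ (Qp_ne_zero h τ) (by rw [← h1]; ring)
      exact ⟨P, hP1, fun i hi => hP2 i (by omega), fun h => absurd h0 h, hP4⟩
    have hζ : ee (1 / h) ^ (K + 1) = 1 := by
      have hc : ContinuousAt (fun q => g (ee (1 / h) * q)) 0 :=
        ContinuousAt.comp (f := fun q => ee (1 / h) * q) (by simpa using hg.continuousAt_zero)
          (by fun_prop)
      have := apply_zero_eq_of_Qp hh hc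
        (hg.continuousAt_zero.const_mul (ee (1 / h) ^ (K + 1))) fun τ => by
          rw [← Qp_T, ← hfg, ← hfg, hf, Qp_T]; ring
      simp only [mul_zero] at this
      exact mul_right_cancel₀ h0 (by rw [← this, one_mul])
    obtain ⟨d, hd⟩ : ∃ d, h * d = K + 1 := by
      rw [← ee_nat_mul, ee_eq_one_iff] at hζ
      obtain ⟨m, hm⟩ := hζ
      have hh' : (h : ℂ) ≠ 0 := by exact_mod_cast hh.ne'
      field_simp at hm
      have hm' : ((K + 1 : ℕ) : ℤ) = h * m := by exact_mod_cast hm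
      obtain ⟨d, hd⟩ : h ∣ K + 1 := by exact_mod_cast Dvd.intro _ hm'.symm
      exact ⟨d, hd.symm⟩
    obtain ⟨J, hJ, hJ0, hJj⟩ := exists_jInv_eq
    have hJh : IntegralSeries fun q => J (1 * q ^ h) :=
      hJ.comp_const_mul_pow isIntegral_one (by simp) hh
    have hgi : IsIntegral ℤ (g 0) := hg.isIntegral_apply_zero
    obtain ⟨g', hg', hgg'⟩ :=
      (hg.add ((IntegralSeries.const hgi).mul (hJh.pow d)).neg).exists_eq_mul
      (by simp [hJ0, zero_pow hh.ne'])
    obtain ⟨P, hP1, hP2, -, hP4⟩ := ih (fun τ => f τ - g 0 * jInv τ ^ d) g'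
      (fun γ τ => by simp only [hf, jInv_smul]) hg' fun τ => by
        have h1 := hgg' (Qp h τ)
        simp only [Pi.add_apply, Pi.neg_apply, Pi.mul_apply, Pi.pow_apply, one_mul] at h1
        rw [← hfg, Qp_pow_self hh, ← hJj, mul_pow, ← Qp_pow_self hh, ← pow_mul, hd] at h1
        exact mul_left_cancel₀ (Qp_ne_zero h τ) (by rw [← h1]; ring)
    refine ⟨P + C (g 0) * X ^ d, fun i => ?_, fun i hi => ?_, fun _ => ⟨d, hd, ?_⟩, fun τ => ?_⟩
    · rw [coeff_add, coeff_C_mul_X_pow]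
      split_ifs
      exacts [(hP1 i).add hgi, (hP1 i).add isIntegral_zero]
    · rw [coeff_add, coeff_C_mul_X_pow, if_neg, hP2 i (by omega), add_zero]
      rintro rfl
      omega
    · rw [coeff_add, coeff_C_mul_X_pow, if_pos rfl, hP2 d (by omega), zero_add]
    · rw [eval_add, ← hP4]
      simp

/-- The ring of functions with a meromorphic `exp (2πiτ / h)`-expansion at infinity, convergent on
the whole upper half-plane, whose coefficients are algebraic integers. -/
def qRing (h : ℕ) : Subring (ℍ → ℂ) where
  carrier := {f | ∃ (K : ℕ) (g : ℂ → ℂ), IntegralSeries g ∧ ∀ τ, f τ * Qp h τ ^ K = g (Qp h τ)}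
  mul_mem' := by
    rintro f₁ f₂ ⟨K₁, g₁, h₁, h₁'⟩ ⟨K₂, g₂, h₂, h₂'⟩
    refine ⟨K₁ + K₂, g₁ * g₂, h₁.mul h₂, fun τ => ?_⟩
    rw [Pi.mul_apply, Pi.mul_apply, ← h₁', ← h₂']
    ring
  one_mem' := ⟨0, fun _ => 1, .const isIntegral_one, by simp⟩
  zero_mem' := ⟨0, fun _ => 0, .const isIntegral_zero, by simp⟩
  add_mem' := by
    rintro f₁ f₂ ⟨K₁, g₁, h₁, h₁'⟩ ⟨K₂, g₂, h₂, h₂'⟩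
    refine ⟨K₁ + K₂, _, (h₁.mul (.const_mul_pow isIntegral_one K₂)).add
      (h₂.mul (.const_mul_pow isIntegral_one K₁)), fun τ => ?_⟩
    simp only [Pi.add_apply, Pi.mul_apply, ← h₁', ← h₂']
    ring
  neg_mem' := by
    rintro f ⟨K, g, h, h'⟩
    exact ⟨K, -g, h.neg, fun τ => by simp [← h']⟩

lemma IntegralSeries.comp_Qp_mem {g : ℂ → ℂ} (hg : IntegralSeries g) (h : ℕ) :
    (fun τ => g (Qp h τ)) ∈ qRing h := ⟨0, g, hg, by simp⟩

section Polynomial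

open Polynomial

lemma isIntegral_of_isIntegral_coeff {P : ℂ[X]} (hP : ∀ i, IsIntegral ℤ (P.coeff i))
    (h0 : P ≠ 0) (hl : IsIntegral ℤ P.leadingCoeff⁻¹) {x : ℂ} (hx : P.eval x = 0) :
    IsIntegral ℤ x := by
  set p := C P.leadingCoeff⁻¹ * P with hp
  have hpm : p.Monic := by
    rw [hp, mul_comm]; exact monic_mul_leadingCoeff_inv h0
  have hlift : p ∈ lifts (algebraMap (integralClosure ℤ ℂ) ℂ) := by
    rw [lifts_iff_coeff_lifts]
    intro n
    rw [hp, coeff_C_mul]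
    exact ⟨⟨_, hl.mul (hP n)⟩, rfl⟩
  obtain ⟨q, hq, -, hqm⟩ := lifts_and_natDegree_eq_and_monic hlift hpm
  have : IsIntegral (integralClosure ℤ ℂ) x := by
    refine ⟨q, hqm, ?_⟩
    rw [eval₂_eq_eval_map, hq, hp, eval_mul, hx, mul_zero]
  exact isIntegral_trans x this

lemma prod_comp_smul {α : Type*} [CommMonoid α] {S : Finset (ℍ → ℂ)}
    (hS : ∀ f ∈ S, ∀ γ : SL(2, ℤ), (fun τ => f (γ • τ)) ∈ S) (γ : SL(2, ℤ)) (F : (ℍ → ℂ) → α) :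
    ∏ f ∈ S, F (fun τ => f (γ • τ)) = ∏ f ∈ S, F f := by
  refine Finset.prod_bij' (fun f _ τ => f (γ • τ)) (fun f _ τ => f (γ⁻¹ • τ))
    (fun f hf => hS f hf γ) (fun f hf => hS f hf γ⁻¹) ?_ ?_ ?_ <;> intros <;> simp

lemma isIntegral_apply_of_finite {h : ℕ} (hh : 0 < h) {S : Finset (ℍ → ℂ)}
    (hS : ∀ f ∈ S, ∀ γ : SL(2, ℤ), (fun τ => f (γ • τ)) ∈ S) (hq : ∀ f ∈ S, f ∈ qRing h)
    {τ : ℍ} (hτ : IsIntegral ℤ (jInv τ)) {f : ℍ → ℂ} (hf : f ∈ S) : IsIntegral ℤ (f τ) := by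
  set p : (ℍ → ℂ)[X] := ∏ f ∈ S, (X - C f) with hp
  have hcoeff : ∀ i, p.coeff i ∈ qRing h := by
    have : p ∈ liftsRing (qRing h).subtype := by
      refine Subring.prod_mem _ fun f hf => Subring.sub_mem _ ?_ ?_
      · exact ⟨X, by simp⟩
      · exact ⟨C ⟨f, hq f hf⟩, by simp⟩
    rw [← lifts_iff_liftsRing, lifts_iff_coeff_lifts] at this
    intro i
    obtain ⟨c, hc⟩ := this i
    rw [← hc]
    exact c.2
  have hinv : ∀ (i) (γ : SL(2, ℤ)) τ, p.coeff i (γ • τ) = p.coeff i τ := by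
    intro i γ τ
    let φ (σ : ℍ) : (ℍ → ℂ) →+* ℂ := Pi.evalRingHom _ σ
    have key : ∀ σ, p.map (φ σ) = ∏ f ∈ S, (X - C (f σ)) := fun σ => by
      simp [hp, Polynomial.map_prod, φ]
    have := prod_comp_smul hS γ fun f => (X - C (f τ))
    rw [← key τ] at this
    simp only [← key (γ • τ)] at this
    have := congrArg (fun P => P.coeff i) this
    simpa [coeff_map, φ] using this
  have hint : ∀ i, IsIntegral ℤ (p.coeff i τ) := by
    intro i
    obtain ⟨K, g, hg, hfg⟩ := hcoeff i
    obtain ⟨P, hP, -, -, hPj⟩ := exists_polynomial_jInv hh K _ g (hinv i) hg hfg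
    rw [hPj, eval_eq_sum_range]
    exact IsIntegral.sum _ fun i _ => (hP i).mul (hτ.pow i)
  have hpm : p.Monic := monic_prod_of_monic _ _ fun f _ => monic_X_sub_C f
  refine isIntegral_of_isIntegral_coeff (P := p.map (Pi.evalRingHom _ τ)) (fun i => ?_)
    (hpm.map _).ne_zero ?_ ?_
  · rw [coeff_map]; exact hint i
  · rw [(hpm.map _).leadingCoeff, inv_one]; exact isIntegral_one
  · rw [hp, Polynomial.map_prod, eval_prod]
    exact Finset.prod_eq_zero hf (by simp)

end Polynomial

/-- Functions with an integral `exp (2πiτ / h)`-expansion whose leading coefficient is a unit. -/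
def UnitLead (h : ℕ) (f : ℍ → ℂ) : Prop :=
  ∃ (K : ℕ) (g : ℂ → ℂ), IntegralSeries g ∧ g 0 ≠ 0 ∧ IsIntegral ℤ (g 0)⁻¹ ∧
    ∀ τ, f τ * Qp h τ ^ K = g (Qp h τ)

lemma UnitLead.prod {h : ℕ} {ι : Type*} {s : Finset ι} {F : ι → ℍ → ℂ}
    (hF : ∀ i ∈ s, UnitLead h (F i)) : UnitLead h (fun τ => ∏ i ∈ s, F i τ) := by
  classical
  induction s using Finset.induction_on with
  | empty => exact ⟨0, fun _ => 1, .const isIntegral_one, by simp, by simp [isIntegral_one], by simp⟩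
  | insert a s ha ih =>
    obtain ⟨K₁, g₁, h₁, h₂, h₃, h₄⟩ := hF a (Finset.mem_insert_self a s)
    obtain ⟨K₂, g₂, i₁, i₂, i₃, i₄⟩ := ih fun i hi => hF i (Finset.mem_insert_of_mem hi)
    refine ⟨K₁ + K₂, g₁ * g₂, h₁.mul i₁, mul_ne_zero h₂ i₂, ?_, fun τ => ?_⟩
    · rw [Pi.mul_apply, mul_inv]; exact h₃.mul i₃
    · simp only [Finset.prod_insert ha]
      rw [Pi.mul_apply, ← h₄, ← i₄]; ring

open Polynomial in
lemma isIntegral_jInv_of_unitLead {h : ℕ} (hh : 0 < h) {f : ℍ → ℂ} (hf : UnitLead h f)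
    (hinv : ∀ (γ : SL(2, ℤ)) τ, f (γ • τ) = f τ) {τ : ℍ} (hτ : f τ = 0) :
    IsIntegral ℤ (jInv τ) := by
  obtain ⟨K, g, hg, hg0, hg1, hfg⟩ := hf
  obtain ⟨P, hP, hP0, hPl, hPj⟩ := exists_polynomial_jInv hh K f g hinv hg hfg
  obtain ⟨d, hd, hPd⟩ := hPl hg0
  have hdeg : P.natDegree = d := by
    refine natDegree_eq_of_le_of_coeff_ne_zero (natDegree_le_iff_coeff_eq_zero.2 fun i hi => ?_)
      (hPd ▸ hg0)
    exact hP0 i (by rw [← hd]; exact Nat.mul_lt_mul_of_pos_left hi hh)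
  refine isIntegral_of_isIntegral_coeff hP ?_ ?_ (by rw [← hPj, hτ])
  · rintro rfl
    exact hg0 (by simp [← hPd])
  · rwa [leadingCoeff, hdeg, hPd]

/-- The element of `FixedDetMatrix` with a given underlying matrix. -/
def fixedDet {m : ℤ} (B : Matrix (Fin 2) (Fin 2) ℤ) (h : B.det = m) :
    FixedDetMatrix (Fin 2) ℤ m := ⟨B, h⟩

lemma coe_fixedDet {m : ℤ} (B : Matrix (Fin 2) (Fin 2) ℤ) (h : B.det = m) :
    (fixedDet B h).1 = B := rfl

/-- An integral matrix of positive determinant as an element of `GL₂(ℝ)`. -/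
def glOf {m : ℤ} (hm : 0 < m) (A : FixedDetMatrix (Fin 2) ℤ m) : GL (Fin 2) ℝ :=
  Matrix.GeneralLinearGroup.mkOfDetNeZero (A.1.map (Int.castRingHom ℝ)) (by
    rw [← RingHom.mapMatrix_apply, ← RingHom.map_det, A.2]
    simpa using hm.ne')

lemma glOf_apply {m : ℤ} (hm : 0 < m) (A : FixedDetMatrix (Fin 2) ℤ m) (i j : Fin 2) :
    glOf hm A i j = (A.1 i j : ℝ) := rfl

lemma coe_glOf_smul {m : ℤ} (hm : 0 < m) (A : FixedDetMatrix (Fin 2) ℤ m) (τ : ℍ) :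
    ((glOf hm A • τ : ℍ) : ℂ) = (A.1 0 0 * τ + A.1 0 1) / (A.1 1 0 * τ + A.1 1 1) := by
  rw [coe_smul_of_det_pos]
  · simp [num, denom, glOf_apply]
  · have : (glOf hm A).det.val = (m : ℝ) := by
      rw [Matrix.GeneralLinearGroup.val_det_apply]
      change (A.1.map (Int.castRingHom ℝ)).det = _
      rw [← RingHom.mapMatrix_apply, ← RingHom.map_det, A.2]
      simp
    rw [this]
    exact_mod_cast hm

lemma glOf_smul {m : ℤ} (hm : 0 < m) (γ : SL(2, ℤ)) (A : FixedDetMatrix (Fin 2) ℤ m) :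
    glOf hm (γ • A) = Matrix.SpecialLinearGroup.mapGL ℝ γ * glOf hm A := by
  ext i j
  rw [glOf_apply, FixedDetMatrices.smul_coe, Matrix.GeneralLinearGroup.coe_mul, Matrix.mul_apply,
    Matrix.mul_apply]
  simp [glOf_apply]

lemma exists_glOf_eq_mul {m : ℤ} (hm : 0 < m) (γ : SL(2, ℤ)) (A : FixedDetMatrix (Fin 2) ℤ m) :
    ∃ B, glOf hm B = glOf hm A * Matrix.SpecialLinearGroup.mapGL ℝ γ := by
  refine ⟨fixedDet (A.1 * γ.1) (by rw [Matrix.det_mul, A.2, γ.2, mul_one]), ?_⟩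
  ext i j
  rw [glOf_apply, coe_fixedDet, Matrix.GeneralLinearGroup.coe_mul, Matrix.mul_apply,
    Matrix.mul_apply]
  simp [glOf_apply]

/-- The translate of `j` by an integral matrix. -/
def jMat {m : ℤ} (hm : 0 < m) (A : FixedDetMatrix (Fin 2) ℤ m) (τ : ℍ) : ℂ := jInv (glOf hm A • τ)

lemma jMat_smul {m : ℤ} (hm : 0 < m) (γ : SL(2, ℤ)) (A : FixedDetMatrix (Fin 2) ℤ m) :
    jMat hm (γ • A) = jMat hm A := by
  ext τ
  rw [jMat, jMat, glOf_smul, mul_smul]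
  exact jInv_smul γ _

lemma exists_reps_jMat_eq {m : ℤ} (hm : 0 < m) (A : FixedDetMatrix (Fin 2) ℤ m) :
    ∃ R ∈ FixedDetMatrices.reps m, jMat hm R = jMat hm A := by
  induction A using FixedDetMatrices.induction_on hm.ne' with
  | h0 A h1 h2 h3 h4 => exact ⟨A, ⟨h1, h2, h3, h4⟩, rfl⟩
  | hS B ih => simpa only [jMat_smul] using ih
  | hT B ih => simpa only [jMat_smul] using ih

lemma finite_range_jMat {m : ℤ} (hm : 0 < m) : (Set.range (jMat hm)).Finite := by
  have : (FixedDetMatrices.reps m).Finite := Set.toFinite _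
  refine (this.image (jMat hm)).subset ?_
  rintro _ ⟨A, rfl⟩
  exact exists_reps_jMat_eq hm A

lemma jMat_comp_smul_mem {m : ℤ} (hm : 0 < m) {f : ℍ → ℂ} (hf : f ∈ Set.range (jMat hm))
    (γ : SL(2, ℤ)) : (fun τ => f (γ • τ)) ∈ Set.range (jMat hm) := by
  obtain ⟨A, rfl⟩ := hf
  obtain ⟨B, hB⟩ := exists_glOf_eq_mul hm γ A
  refine ⟨B, funext fun τ => ?_⟩
  rw [jMat, jMat, hB, mul_smul]
  rfl

lemma isIntegral_ee_div {b d : ℤ} (hd : 0 < d) : IsIntegral ℤ (ee (b / d)) := by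
  obtain ⟨n, rfl⟩ := Int.eq_ofNat_of_zero_le hd.le
  have hn : (n : ℂ) ≠ 0 := by exact_mod_cast hd.ne'
  refine IsIntegral.of_pow (n := n) (by exact_mod_cast hd) ?_
  rw [← ee_nat_mul, Int.cast_natCast, mul_div_cancel₀ _ hn, ee_int]
  exact isIntegral_one

lemma norm_ee_div (b d : ℤ) : ‖ee (b / d)‖ = 1 := by
  rw [norm_ee, ← ofReal_intCast, ← ofReal_intCast, ← ofReal_div, ofReal_im]
  simp

lemma unitLead_jInv_sub_jMat {m : ℕ} (hm : 0 < (m : ℤ)) (hsq : ∀ a : ℤ, a * a ≠ m)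
    {A : FixedDetMatrix (Fin 2) ℤ m} (hA : A ∈ FixedDetMatrices.reps (m : ℤ)) :
    UnitLead m (fun τ => jInv τ - jMat hm A τ) := by
  obtain ⟨h10, h00, -, -⟩ := hA
  have hm' : 0 < m := by exact_mod_cast hm
  obtain ⟨a, ha⟩ := Int.eq_ofNat_of_zero_le h00.le
  have hdet : (a : ℤ) * A.1 1 1 = m := by
    have := A.2
    rw [Matrix.det_fin_two, h10, mul_zero, sub_zero, ha] at this
    exact this
  have ha0 : 0 < a := by
    have := ha ▸ h00
    exact_mod_cast this
  obtain ⟨b, hb⟩ : ∃ b, A.1 0 1 = b := ⟨_, rfl⟩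
  obtain ⟨d, hd⟩ : ∃ d, A.1 1 1 = d := ⟨_, rfl⟩
  rw [hd] at hdet
  have hd0 : 0 < d := by
    by_contra! h
    nlinarith
  set η := ee (b / d) with hη
  have hηi : IsIntegral ℤ η := isIntegral_ee_div hd0
  have hηi' : IsIntegral ℤ η⁻¹ := by
    rw [hη, ← ee_neg, ← neg_div]
    exact_mod_cast isIntegral_ee_div (b := -b) hd0
  have hη0 : η ≠ 0 := ee_ne_zero _
  obtain ⟨J, hJ, hJ0, hJj⟩ := exists_jInv_eq
  have hA' : ∀ τ : ℍ, ee (glOf hm A • τ : ℍ) = η * Qp m τ ^ (a * a) := by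
    intro τ
    rw [coe_glOf_smul, h10, ha, hb, hd, hη, Qp, ← ee_nat_mul, ← ee_add]
    have h1 : (m : ℂ) = a * d := by exact_mod_cast hdet.symm
    have h2 : (a : ℂ) ≠ 0 := by exact_mod_cast ha0.ne'
    have h3 : (d : ℂ) ≠ 0 := by exact_mod_cast hd0.ne'
    rw [h1]
    congr 1
    push_cast
    simp only [zero_mul, zero_add]
    field_simp
    ring
  have hJA : ∀ τ : ℍ, jMat hm A τ * Qp m τ ^ (a * a) = η⁻¹ * J (η * Qp m τ ^ (a * a)) := by
    intro τ
    rw [← hA', ← hJj, hA', jMat]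
    field_simp
  have hJm : ∀ τ : ℍ, jInv τ * Qp m τ ^ m = J (1 * Qp m τ ^ m) := by
    intro τ
    rw [one_mul, Qp_pow_self hm', hJj]
  have g1 : IntegralSeries fun q => J (1 * q ^ m) :=
    hJ.comp_const_mul_pow isIntegral_one (by simp) hm'
  have g2 : IntegralSeries fun q => J (η * q ^ (a * a)) :=
    hJ.comp_const_mul_pow hηi (norm_ee_div _ _).le (by positivity)
  have g3 := (IntegralSeries.const hηi').mul g2
  have hne : a * a ≠ m := by exact_mod_cast hsq a
  rcases lt_or_gt_of_ne hne with hlt | hlt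
  · refine ⟨m, _, g1.add ((IntegralSeries.const_mul_pow isIntegral_one (m - a * a)).mul g3).neg,
      ?_, ?_, fun τ => ?_⟩
    · simp [hJ0, hm'.ne', (Nat.sub_pos_of_lt hlt).ne']
    · simp [hJ0, hm'.ne', (Nat.sub_pos_of_lt hlt).ne', isIntegral_one]
    · simp only [Pi.add_apply, Pi.neg_apply, Pi.mul_apply]
      rw [← hJm, ← hJA, sub_mul]
      rw [mul_left_comm, one_mul, ← pow_add, Nat.sub_add_cancel hlt.le]
      ring
  · refine ⟨a * a, _, ((IntegralSeries.const_mul_pow isIntegral_one (a * a - m)).mul g1).add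
      g3.neg, ?_, ?_, fun τ => ?_⟩
    · simp [hJ0, ha0.ne', (Nat.sub_pos_of_lt hlt).ne', hη0]
    · simp [hJ0, ha0.ne', (Nat.sub_pos_of_lt hlt).ne', hηi, inv_neg]
    · simp only [Pi.add_apply, Pi.neg_apply, Pi.mul_apply]
      rw [← hJm, ← hJA, sub_mul, one_mul]
      rw [mul_left_comm, ← pow_add, Nat.sub_add_cancel hlt.le]
      ring

/-- Singular moduli are algebraic integers. -/
lemma isIntegral_jInv_of_smul_eq {m : ℕ} (hm : 0 < (m : ℤ)) (hsq : ∀ a : ℤ, a * a ≠ m)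
    (A : FixedDetMatrix (Fin 2) ℤ m) {τ : ℍ} (hA : glOf hm A • τ = τ) :
    IsIntegral ℤ (jInv τ) := by
  set S := (finite_range_jMat hm).toFinset
  have hmem : ∀ f, f ∈ S ↔ f ∈ Set.range (jMat hm) := fun f => Set.Finite.mem_toFinset _
  refine isIntegral_jInv_of_unitLead (h := m) (by exact_mod_cast hm)
    (f := fun τ => ∏ f ∈ S, (jInv τ - f τ)) (UnitLead.prod fun f hf => ?_) (fun γ τ => ?_) ?_
  · obtain ⟨B, rfl⟩ := (hmem _).1 hf
    obtain ⟨R, hR, hRB⟩ := exists_reps_jMat_eq hm B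
    rw [← hRB]
    exact unitLead_jInv_sub_jMat hm hsq hR
  · rw [jInv_smul]
    refine prod_comp_smul (fun f hf γ => ?_) γ fun f => jInv τ - f τ
    exact (hmem _).2 (jMat_comp_smul_mem hm ((hmem _).1 hf) γ)
  · refine Finset.prod_eq_zero ((hmem (jMat hm A)).2 ⟨A, rfl⟩) ?_
    rw [jMat, hA, sub_self]

/-- The `j`-invariant of an imaginary quadratic point is an algebraic integer. -/
lemma isIntegral_jInv_of_quadratic {τ : ℍ} {a b c : ℤ} (ha : 0 < a)
    (h : (a : ℂ) * τ ^ 2 + b * τ + c = 0) : IsIntegral ℤ (jInv τ) := by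
  obtain ⟨k, hk, hsq⟩ : ∃ k : ℤ, 0 < k * k - k * b + a * c ∧
      ∀ x : ℤ, x * x ≠ k * k - k * b + a * c := by
    have hD : (0 : ℤ) < 4 * a * c - b ^ 2 := by
      have h1 := congrArg Complex.re h
      have h2 := congrArg Complex.im h
      simp [pow_two] at h1 h2
      have hy := τ.im_pos
      have ha' : (0 : ℝ) < a := by exact_mod_cast ha
      have h3 : 2 * a * τ.re + b = 0 := by
        refine ((mul_eq_zero (b := τ.im)).1 ?_).resolve_right hy.ne'
        linear_combination h2
      have h4 : (4 * a * c - b ^ 2 : ℝ) = (2 * a * τ.im) ^ 2 := by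
        linear_combination 4 * a * h1 - (2 * a * τ.re + b) * h3
      have h5 : (0 : ℝ) < 4 * a * c - b ^ 2 := by rw [h4]; positivity
      exact_mod_cast h5
    obtain ⟨k, hk⟩ : ∃ k : ℤ, 4 * a * c - b ^ 2 < 2 * k - b :=
      ⟨4 * a * c - b ^ 2 + |b|, by nlinarith [le_abs_self b, abs_nonneg b]⟩
    refine ⟨k, by nlinarith [sq_nonneg (2 * k - b)], fun x hx => ?_⟩
    have h1 : (2 * |x|) ^ 2 = (2 * k - b) ^ 2 + (4 * a * c - b ^ 2) := by
      rw [mul_pow, sq_abs]; linear_combination 4 * hx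
    have h2 : 2 * k - b < 2 * |x| := by
      by_contra! h3
      nlinarith [abs_nonneg x]
    nlinarith
  obtain ⟨m, hm⟩ := Int.eq_ofNat_of_zero_le hk.le
  rw [hm] at hk hsq
  refine isIntegral_jInv_of_smul_eq hk hsq (fixedDet !![k - b, -c; a, k] ?_) ?_
  · rw [Matrix.det_fin_two_of, ← hm]; ring
  · ext
    rw [coe_glOf_smul, coe_fixedDet]
    have hne : (a : ℂ) * τ + k ≠ 0 := fun h0 => by
      have := congrArg Complex.im h0
      simp [ha.ne', τ.im_ne_zero] at this
    simp only [Matrix.of_apply, Matrix.cons_val', Matrix.cons_val_zero, Matrix.cons_val_one,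
      Matrix.cons_val_fin_one]
    push_cast
    rw [div_eq_iff hne]
    linear_combination -h

/-- Units of the ring `qRing h`. -/
def QUnit (h : ℕ) (f : ℍ → ℂ) : Prop := f ∈ qRing h ∧ f⁻¹ ∈ qRing h

namespace QUnit

variable {h : ℕ} {f g : ℍ → ℂ}

protected lemma mul (hf : QUnit h f) (hg : QUnit h g) : QUnit h (f * g) :=
  ⟨mul_mem hf.1 hg.1, by rw [mul_inv]; exact mul_mem hf.2 hg.2⟩

protected lemma inv (hf : QUnit h f) : QUnit h f⁻¹ := ⟨hf.2, by rw [inv_inv]; exact hf.1⟩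

protected lemma pow (hf : QUnit h f) (n : ℕ) : QUnit h (f ^ n) :=
  ⟨pow_mem hf.1 n, by rw [← inv_pow]; exact pow_mem hf.2 n⟩

protected lemma const {c : ℂ} (hc : IsIntegral ℤ c) (hc' : IsIntegral ℤ c⁻¹) :
    QUnit h fun _ => c :=
  ⟨(IntegralSeries.const hc).comp_Qp_mem h, (IntegralSeries.const hc').comp_Qp_mem h⟩

lemma qp : QUnit h (Qp h) :=
  ⟨⟨0, fun q => 1 * q ^ 1, .const_mul_pow isIntegral_one 1, by simp⟩,
    ⟨1, fun _ => 1, .const isIntegral_one, fun τ => by simp [Qp_ne_zero]⟩⟩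

lemma qp_zpow (n : ℤ) : QUnit h fun τ => Qp h τ ^ n := by
  obtain ⟨m, rfl | rfl⟩ := n.eq_nat_or_neg
  · simpa using! (qp (h := h)).pow m
  · simpa using! ((qp (h := h)).pow m).inv

lemma comp_Qp {F : ℂ → ℂ} (hF : IntegralSeries F) (h0 : ∀ q, ‖q‖ < 1 → F q ≠ 0)
    (h1 : IsIntegral ℤ (F 0)⁻¹) : QUnit h fun τ => F (Qp h τ) :=
  ⟨hF.comp_Qp_mem h, (hF.inv h0 h1).comp_Qp_mem h⟩

lemma poch (hh : 0 < h) {r : ℕ} (hr : 0 < r) {η : ℂ} (hη : IsIntegral ℤ η) (hη1 : ‖η‖ ≤ 1) :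
    QUnit h fun τ : ℍ => poch (ee τ) (η * Qp h τ ^ r) := by
  simp only [← Qp_pow_self hh]
  exact comp_Qp (IntegralSeries.poch hh hr hη)
    (fun q hq => poch_monomial_ne_zero hh hr hη1 hq)
    (by simp [hr.ne', poch_zero_right, isIntegral_one])

end QUnit

lemma isIntegral_one_sub_zpow_div {η : ℂ} (h0 : η ≠ 0) (hη : IsIntegral ℤ η)
    (hη' : IsIntegral ℤ η⁻¹) (n : ℤ) : IsIntegral ℤ ((1 - η ^ n) / (1 - η)) := by
  rcases eq_or_ne η 1 with rfl | h1
  · simpa using isIntegral_zero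
  have h1' : 1 - η ≠ 0 := sub_ne_zero.2 h1.symm
  have hnat : ∀ n : ℕ, IsIntegral ℤ ((1 - η ^ n) / (1 - η)) := fun n => by
    rw [← geom_sum_mul_neg, mul_div_cancel_right₀ _ h1']
    exact IsIntegral.sum _ fun i _ => hη.pow i
  obtain ⟨m, rfl | rfl⟩ := n.eq_nat_or_neg
  · exact_mod_cast hnat m
  · have : (1 - η ^ (-(m : ℤ))) / (1 - η) = -(η⁻¹ ^ m * ((1 - η ^ m) / (1 - η))) := by
      rw [zpow_neg, zpow_natCast, inv_pow]
      field_simp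
      ring
    rw [this]
    exact ((hη'.pow m).mul (hnat m)).neg

lemma isIntegral_one_sub_ee_div {N : ℕ} (hN : 0 < N) (x y : ℤ) :
    IsIntegral ℤ ((1 - ee (x * (y / N))) / (1 - ee (y / N))) := by
  have hN' : (0 : ℤ) < N := by exact_mod_cast hN
  rw [ee_int_mul]
  have h1 := isIntegral_ee_div (b := y) hN'
  have h2 := isIntegral_ee_div (b := -y) hN'
  rw [Int.cast_neg, neg_div, ee_neg] at h2
  exact isIntegral_one_sub_zpow_div (ee_ne_zero _) (by simpa using h1) (by simpa using h2) x

lemma one_sub_ee_div_ne_zero {N : ℕ} (hN : 2 ≤ N) {y : ℤ} (hy : IsCoprime y N) :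
    1 - ee (y / N) ≠ 0 := by
  rw [sub_ne_zero, ne_comm, Ne, ee_eq_one_iff]
  rintro ⟨m, hm⟩
  have hN' : (N : ℂ) ≠ 0 := by norm_cast; omega
  rw [div_eq_iff hN'] at hm
  have : y = m * N := by exact_mod_cast hm
  have h1 : IsUnit (N : ℤ) := hy.isUnit_of_dvd' ⟨m, by rw [this, mul_comm]⟩ dvd_rfl
  rw [Int.isUnit_iff] at h1
  omega

/-- The values of `thetaProd` at primitive `N`-torsion points are units up to a common factor. -/
lemma exists_thetaProd_eq {N : ℕ} (hN : 2 ≤ N) {k c d : ℤ} (hk : IsCoprime k N)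
    (hcd : IsCoprime c d) : ∃ u, QUnit N u ∧ ∀ τ : ℍ,
      thetaProd τ (k * ((c * τ + d) / N)) =
        (if (N : ℤ) ∣ c then 1 - ee ((1 : ℤ) / N) else 1) * u τ := by
  have hN0 : 0 < N := by omega
  have hN' : (0 : ℤ) < N := by exact_mod_cast hN0
  have hNC : (N : ℂ) ≠ 0 := by exact_mod_cast hN0.ne'
  set ϖ : ℂ := if (N : ℤ) ∣ c then 1 - ee ((1 : ℤ) / N) else 1 with hϖ
  set y := k * d with hy
  let P : ℤ → Prop := fun x => ∃ u, QUnit N u ∧ ∀ τ : ℍ,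
    thetaProd τ ((x * τ + y) / N) = ϖ * u τ
  have hunit : ∀ b : ℤ, IsIntegral ℤ (ee (b / N)) := fun b => by
    simpa using isIntegral_ee_div (b := b) hN'
  have hunit' : ∀ b : ℤ, IsIntegral ℤ (ee (b / N))⁻¹ := fun b => by
    rw [← ee_neg, ← neg_div]; exact_mod_cast hunit (-b)
  have hnorm : ∀ b : ℤ, ‖ee (b / N)‖ ≤ 1 := fun b => by
    simpa using (norm_ee_div b N).le
  have hmono : ∀ x : ℤ, ∃ v, QUnit N v ∧ (∀ τ, v τ ≠ 0) ∧ ∀ τ : ℍ,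
      thetaProd τ (((x + N : ℤ) * τ + y) / N) = v τ * thetaProd τ ((x * τ + y) / N) := by
    intro x
    refine ⟨_, (QUnit.const (hunit (-y)).neg ?_).mul (QUnit.qp_zpow (-x)), fun τ => ?_, fun τ => ?_⟩
    · rw [inv_neg]; exact (hunit' _).neg
    · exact mul_ne_zero (neg_ne_zero.2 (ee_ne_zero _)) (zpow_ne_zero _ (Qp_ne_zero _ _))
    · have : ((x + N : ℤ) * (τ : ℂ) + y) / N = (x * τ + y) / N + τ := by
        push_cast; field_simp; ring
      have hsplit : ee (-((x * (τ : ℂ) + y) / N)) =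
          ee ((-y : ℤ) / N) * ee ((-x : ℤ) * (τ / N)) := by
        rw [← ee_add]
        congr 1
        push_cast; field_simp; ring
      rw [this, thetaProd_add_tau τ.im_pos, Pi.mul_apply, Qp, ← ee_int_mul, hsplit]
      ring
  have hper : Function.Periodic P N := by
    intro x
    obtain ⟨v, hv, hv0, hvx⟩ := hmono x
    refine propext ⟨?_, ?_⟩
    · rintro ⟨u, hu, h⟩
      refine ⟨v⁻¹ * u, hv.inv.mul hu, fun τ => ?_⟩
      have := hv0 τ
      rw [Pi.mul_apply, mul_left_comm, ← h, hvx, Pi.inv_apply, inv_mul_cancel_left₀ this]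
    · rintro ⟨u, hu, h⟩
      refine ⟨v * u, hv.mul hu, fun τ => ?_⟩
      rw [hvx, h, Pi.mul_apply]; ring
  suffices hP : P (k * c % N) by
    rw [Int.emod_def, mul_comm (N : ℤ), ← smul_eq_mul (_ / _), hper.sub_zsmul_eq] at hP
    obtain ⟨u, hu, h⟩ := hP
    refine ⟨u, hu, fun τ => ?_⟩
    rw [← h]
    congr 1
    push_cast [hy]; ring
  have hdvd : (N : ℤ) ∣ k * c ↔ (N : ℤ) ∣ c :=
    ⟨hk.symm.dvd_of_dvd_mul_left, fun h => h.mul_left k⟩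
  obtain ⟨r, hr⟩ := Int.eq_ofNat_of_zero_le (Int.emod_nonneg (k * c) hN'.ne')
  have hrN : r < N := by
    have := Int.emod_lt_of_pos (k * c) hN'
    rw [hr] at this
    exact_mod_cast this
  rw [hr]
  rcases Nat.eq_zero_or_pos r with rfl | hr0
  · have hNc : (N : ℤ) ∣ c := hdvd.1 (Int.dvd_of_emod_eq_zero (by simpa using hr))
    have hyN : IsCoprime y N := by
      refine hk.mul_left (hcd.symm.of_isCoprime_of_dvd_right hNc)
    obtain ⟨s, t, hst⟩ := hyN
    have hζ : ee ((1 : ℤ) / N) = ee (s * (y / N)) := by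
      have : ((1 : ℤ) : ℂ) / N = s * (y / N) + t := by
        field_simp
        have : (s * y + t * N : ℂ) = 1 := by exact_mod_cast hst
        push_cast
        linear_combination -this
      rw [this, ee_add, ee_int, mul_one]
    have hy1 : ee (y / N) = ee (y * ((1 : ℤ) / N)) := by
      congr 1; push_cast; ring
    have h1 : 1 - ee ((1 : ℤ) / N) ≠ 0 := one_sub_ee_div_ne_zero hN isCoprime_one_left
    have hc : QUnit N fun _ => (1 - ee (y / N)) / (1 - ee ((1 : ℤ) / N)) := by
      refine QUnit.const ?_ ?_
      · rw [hy1]; exact isIntegral_one_sub_ee_div hN0 _ _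
      · rw [inv_div, hζ]; exact isIntegral_one_sub_ee_div hN0 _ _
    refine ⟨_, hc.mul ((QUnit.poch hN0 hN0 (hunit y) (hnorm y)).mul
      (QUnit.poch hN0 hN0 (hunit (-y)) (hnorm (-y)))), fun τ => ?_⟩
    simp only [Pi.mul_apply, hϖ, if_pos hNc]
    rw [Qp_pow_self hN0, thetaProd]
    simp only [Nat.cast_zero, Int.cast_zero, zero_mul, zero_add, Int.cast_neg, neg_div]
    rw [poch_eq_mul (norm_ee_lt_one τ.im_pos) (ee (y / N))]
    rw [mul_comm (ee τ) (ee (y / N))]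
    field_simp
  · have hNc : ¬ (N : ℤ) ∣ c := by
      rw [← hdvd, Int.dvd_iff_emod_eq_zero, hr]
      simpa using hr0.ne'
    refine ⟨_, (QUnit.poch hN0 hr0 (hunit y) (hnorm y)).mul
      (QUnit.poch hN0 (Nat.sub_pos_of_lt hrN) (hunit (-y)) (hnorm (-y))), fun τ => ?_⟩
    simp only [Pi.mul_apply, hϖ, if_neg hNc, one_mul, thetaProd]
    rw [Qp, ← ee_nat_mul, ← ee_nat_mul, ← ee_add, ← ee_add, ← ee_add, Nat.cast_sub hrN.le]
    congr 3
    · push_cast; field_simp; ring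
    · push_cast; field_simp; ring

lemma moebius_eq_smul (γ : SL(2, ℤ)) (τ : ℍ) :
    moebius (γ : Matrix (Fin 2) (Fin 2) ℤ) τ = ↑(γ • τ) := by
  rw [coe_specialLinearGroup_apply]
  simp [moebius]

lemma wp_smul (γ : SL(2, ℤ)) (τ : ℍ) (z : ℂ) : wp ↑(γ • τ) z =
    ((γ 1 0 : ℂ) * τ + γ 1 1) ^ 2 * wp τ (((γ 1 0 : ℂ) * τ + γ 1 1) * z) := by
  have hdet : γ 0 0 * γ 1 1 - γ 0 1 * γ 1 0 = 1 := by
    rw [← Matrix.det_fin_two, Matrix.SpecialLinearGroup.det_coe]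
  set J : ℂ := (γ 1 0 : ℂ) * τ + γ 1 1 with hJ
  have hJ0 : J ≠ 0 := by
    have := denom_ne_zero γ τ
    rwa [ModularGroup.denom_apply] at this
  have hγ : (↑(γ • τ) : ℂ) = ((γ 0 0 : ℂ) * τ + γ 0 1) / J := by
    rw [← moebius_eq_smul, moebius]
  let e : ℤ × ℤ ≃ ℤ × ℤ :=
    { toFun := fun p => (p.1 * γ 1 1 + p.2 * γ 0 1, p.1 * γ 1 0 + p.2 * γ 0 0)
      invFun := fun p => (p.1 * γ 0 0 - p.2 * γ 0 1, -p.1 * γ 1 0 + p.2 * γ 1 1)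
      left_inv := fun p => by
        ext
        · linear_combination p.1 * hdet
        · linear_combination p.2 * hdet
      right_inv := fun p => by
        ext
        · linear_combination p.1 * hdet
        · linear_combination p.2 * hdet }
  have he : ∀ p, p ≠ 0 ↔ e p ≠ 0 := fun p => by
    rw [not_iff_not, ← e.injective.eq_iff (b := 0)]
    simp [e]
  have hω : ∀ p : ℤ × ℤ, (p.1 : ℂ) + p.2 * ↑(γ • τ) = ((e p).1 + (e p).2 * τ) / J := fun p => by
    rw [hγ]
    simp only [e, Equiv.coe_fn_mk]
    push_cast
    field_simp
    rw [hJ]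
    ring
  rw [wp, wp, mul_add, ← tsum_mul_left]
  congr 1
  · rw [mul_pow]; field_simp
  · refine Eq.trans (tsum_congr fun p => ?_) ((e.subtypeEquiv he).tsum_eq _)
    have hz : z - ((e p).1 + (e p).2 * τ) / J = (J * z - ((e p).1 + (e p).2 * τ)) / J := by
      field_simp
    simp only [Equiv.subtypeEquiv_apply]
    rw [hω, hz, div_pow, div_pow, one_div_div, one_div_div, mul_sub, mul_one_div, mul_one_div]

/-- The function `W_𝔞` with the torsion points `aᵢ/N` replaced by `aᵢ(cτ+d)/N`. -/
def torsionRatio (N : ℕ) (a : ℤ × ℤ × ℤ) (c d : ℤ) (τ : ℍ) : ℂ :=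
  (wp τ (a.1 * ((c * τ + d) / N)) - wp τ (a.2.2 * ((c * τ + d) / N))) /
    (wp τ (a.2.1 * ((c * τ + d) / N)) - wp τ (a.2.2 * ((c * τ + d) / N)))

lemma Wfun_smul (N : ℕ) (a : ℤ × ℤ × ℤ) (γ : SL(2, ℤ)) (τ : ℍ) :
    Wfun N a.1 a.2.1 a.2.2 ↑(γ • τ) = torsionRatio N a (γ 1 0) (γ 1 1) τ := by
  have hJ0 : (γ 1 0 : ℂ) * τ + γ 1 1 ≠ 0 := by
    have := denom_ne_zero γ τ
    rwa [ModularGroup.denom_apply] at this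
  have h : ∀ k : ℤ, ((γ 1 0 : ℂ) * τ + γ 1 1) * (k / N) = k * (((γ 1 0 : ℂ) * τ + γ 1 1) / N) :=
    fun k => by ring
  simp only [Wfun, torsionRatio, wp_smul γ τ, h, ← mul_sub]
  rw [mul_div_mul_left _ _ (pow_ne_zero 2 hJ0)]

lemma wp_torsion_congr {N : ℕ} (hN : 0 < N) (k : ℤ) {c d c' d' : ℤ} (hc : c ≡ c' [ZMOD N])
    (hd : d ≡ d' [ZMOD N]) (τ : ℍ) :
    wp τ (k * ((c * τ + d) / N)) = wp τ (k * ((c' * τ + d') / N)) := by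
  obtain ⟨x, hx⟩ := hc.dvd
  obtain ⟨y, hy⟩ := hd.dvd
  have hNC : (N : ℂ) ≠ 0 := by exact_mod_cast hN.ne'
  obtain rfl : c' = c + N * x := by linarith
  obtain rfl : d' = d + N * y := by linarith
  have hl : ((k * y : ℤ) : ℂ) + (k * x : ℤ) * τ ∈ (onePair τ.im_pos).lattice :=
    (mem_onePair _).2 ⟨_, _, rfl⟩
  rw [wp_eq_weierstrassP τ.im_pos, wp_eq_weierstrassP τ.im_pos,
    ← (onePair τ.im_pos).weierstrassP_add_coe _ ⟨_, hl⟩]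
  congr 1
  push_cast
  field_simp
  ring

lemma torsionRatio_congr {N : ℕ} (hN : 0 < N) (a : ℤ × ℤ × ℤ) {c d c' d' : ℤ}
    (hc : c ≡ c' [ZMOD N]) (hd : d ≡ d' [ZMOD N]) :
    torsionRatio N a c d = torsionRatio N a c' d' := by
  funext τ
  simp only [torsionRatio, fun k => wp_torsion_congr hN k hc hd τ]

lemma torsion_notMem_lattice {N : ℕ} (hN : 2 ≤ N) {k c d : ℤ} (hk : IsCoprime k N)
    (hcd : IsCoprime c d) (τ : ℍ) :
    (k * ((c * τ + d) / N) : ℂ) ∉ (onePair τ.im_pos).lattice := by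
  intro hmem
  obtain ⟨m, n, h⟩ := (mem_onePair _).1 hmem
  have hNC : (N : ℂ) ≠ 0 := by norm_cast; omega
  have h' : ((n * N - k * c : ℤ) : ℂ) * τ + (m * N - k * d : ℤ) = 0 := by
    field_simp at h
    push_cast
    linear_combination h
  have him := congrArg Complex.im h'
  have h1 : n * N - k * c = 0 := by
    have : ((n * N - k * c : ℤ) : ℝ) * τ.im = 0 := by simpa using him
    exact_mod_cast (mul_eq_zero.1 this).resolve_right τ.im_pos.ne'
  have h2 : m * N - k * d = 0 := by
    rw [h1] at h'
    exact_mod_cast (by simpa using h' : ((m * N - k * d : ℤ) : ℂ) = 0)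
  have hc : (N : ℤ) ∣ c := hk.symm.dvd_of_dvd_mul_left ⟨n, by linarith⟩
  have hd : (N : ℤ) ∣ d := hk.symm.dvd_of_dvd_mul_left ⟨m, by linarith⟩
  have := Int.isUnit_iff.1 (hcd.isUnit_of_dvd' hc hd)
  omega

lemma torsionRatio_mem_qRing {N : ℕ} (hN : 2 ≤ N) {a : ℤ × ℤ × ℤ} (ha : memE2 N a) {c d : ℤ}
    (hcd : IsCoprime c d) : torsionRatio N a c d ∈ qRing N := by
  obtain ⟨⟨-, h123⟩, h13, h13', h23, h23'⟩ := ha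
  have h12 := h123.of_mul_left_left
  have h1 := h12.of_mul_left_left
  have h2 := h12.of_mul_left_right
  have h3 := h123.of_mul_left_right
  have hϖ : (if (N : ℤ) ∣ c then 1 - ee ((1 : ℤ) / N) else 1) ≠ 0 := by
    split_ifs
    · exact one_sub_ee_div_ne_zero hN isCoprime_one_left
    · exact one_ne_zero
  obtain ⟨u₁, hu₁, e₁⟩ := exists_thetaProd_eq hN h1 hcd
  obtain ⟨u₂, hu₂, e₂⟩ := exists_thetaProd_eq hN h2 hcd
  obtain ⟨u₃, hu₃, e₃⟩ := exists_thetaProd_eq hN h13 hcd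
  obtain ⟨u₄, hu₄, e₄⟩ := exists_thetaProd_eq hN h13' hcd
  obtain ⟨u₅, hu₅, e₅⟩ := exists_thetaProd_eq hN h23 hcd
  obtain ⟨u₆, hu₆, e₆⟩ := exists_thetaProd_eq hN h23' hcd
  convert (((hu₄.mul hu₃).mul (hu₁.pow 2).inv).mul
    ((hu₆.mul hu₅).mul (hu₂.pow 2).inv).inv).1 using 1
  funext τ
  rw [torsionRatio, wp_sub_div_wp_sub τ.im_pos (torsion_notMem_lattice hN h1 hcd τ)
    (torsion_notMem_lattice hN h2 hcd τ) (torsion_notMem_lattice hN h3 hcd τ)]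
  simp only [← add_mul, ← sub_mul, ← Int.cast_add, ← Int.cast_sub, e₁, e₂, e₃, e₄, e₅, e₆,
    Pi.mul_apply, Pi.inv_apply, Pi.pow_apply]
  rw [← div_eq_mul_inv, ← div_eq_mul_inv, ← div_eq_mul_inv]
  congr 1 <;>
  · rw [mul_pow, mul_mul_mul_comm, ← sq, mul_div_mul_left _ _ (pow_ne_zero 2 hϖ)]

lemma isIntegral_Wfun_smul {N : ℕ} (hN : 2 ≤ N) {a : ℤ × ℤ × ℤ} (ha : memE2 N a) {τ : ℍ}
    (hτ : IsIntegral ℤ (jInv τ)) (γ : SL(2, ℤ)) :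
    IsIntegral ℤ (Wfun N a.1 a.2.1 a.2.2 ↑(γ • τ)) := by
  have hN0 : 0 < N := by omega
  have : NeZero N := ⟨hN0.ne'⟩
  let S : Set (ℍ → ℂ) := Set.range fun (δ : SL(2, ℤ)) (τ : ℍ) => Wfun N a.1 a.2.1 a.2.2 ↑(δ • τ)
  have hS : S.Finite := by
    refine (Set.finite_range fun p : ZMod N × ZMod N =>
      torsionRatio N a p.1.val p.2.val).subset ?_
    rintro _ ⟨δ, rfl⟩
    refine ⟨(δ 1 0, δ 1 1), ?_⟩
    simp only [Wfun_smul, ZMod.val_intCast]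
    exact torsionRatio_congr hN0 a (Int.mod_modEq _ _) (Int.mod_modEq _ _)
  refine isIntegral_apply_of_finite hN0 (S := hS.toFinset) (fun f hf δ => ?_) (fun f hf => ?_) hτ
    (f := fun τ => Wfun N a.1 a.2.1 a.2.2 ↑(γ • τ)) (hS.mem_toFinset.2 ⟨γ, rfl⟩)
  · obtain ⟨δ', rfl⟩ := hS.mem_toFinset.1 hf
    exact hS.mem_toFinset.2 ⟨δ' * δ, by simp only [mul_smul]⟩
  · obtain ⟨δ, rfl⟩ := hS.mem_toFinset.1 hf
    simp only [Wfun_smul]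
    refine torsionRatio_mem_qRing hN ha ⟨-δ 0 1, δ 0 0, ?_⟩
    have := δ.det_coe
    rw [Matrix.det_fin_two] at this
    linarith

lemma exists_quadratic_of_natDegree_minpoly {α : ℂ} (halg : IsIntegral ℚ α)
    (hdeg : (minpoly ℚ α).natDegree = 2) :
    ∃ a b c : ℤ, 0 < a ∧ (a : ℂ) * α ^ 2 + b * α + c = 0 := by
  obtain ⟨p, q, h⟩ : ∃ p q : ℚ, α ^ 2 + p * α + q = 0 := by
    have hm := minpoly.monic halg
    have h := minpoly.aeval ℚ α
    rw [Polynomial.aeval_eq_sum_range, hdeg] at h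
    rw [Polynomial.Monic, Polynomial.leadingCoeff, hdeg] at hm
    refine ⟨(minpoly ℚ α).coeff 1, (minpoly ℚ α).coeff 0, ?_⟩
    simp only [Finset.sum_range_succ, Finset.sum_range_zero, hm, Algebra.smul_def] at h
    simp at h
    linear_combination h
  refine ⟨p.den * q.den, p.num * q.den, q.num * p.den, by positivity, ?_⟩
  have hp : (p.den : ℂ) ≠ 0 := by exact_mod_cast p.den_ne_zero
  have hq : (q.den : ℂ) ≠ 0 := by exact_mod_cast q.den_ne_zero
  rw [Rat.cast_def p, Rat.cast_def q] at h
  field_simp at h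
  push_cast
  linear_combination h

end

/-- for odd `N`, all `𝔞ₖ ∈ 𝔈₂` and an imaginary quadratic point `α` of the upper
half-plane, `T_{𝔄,F}(α)` is an algebraic integer. -/
theorem stmt17 (N : ℕ) (hN : 0 < N) (hodd : Odd N) {n : ℕ} (A : Fin n → ℤ × ℤ × ℤ)
    (hA : ∀ i, memE2 N (A i)) (F : MvPolynomial (Fin n) ℤ)
    (M : SNgroup N → SL(2, ℤ))
    (hM : ∀ s, M s ∈ CongruenceSubgroup.Gamma0 N ∧ IsDiagLift N (M s) s)
    (α : ℂ) (hα : 0 < α.im)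
    (halg : IsIntegral ℚ α) (hdeg : (minpoly ℚ α).natDegree = 2) :
    IsIntegral ℤ (Tfun N A F M α) := by
  obtain ⟨a, b, c, ha, habc⟩ := exists_quadratic_of_natDegree_minpoly halg hdeg
  have hj := isIntegral_jInv_of_quadratic (τ := ⟨α, hα⟩) ha habc
  have hW : ∀ (s : SNgroup N) (i : Fin n), IsIntegral ℤ (Wfun N (A i).1 (A i).2.1 (A i).2.2
      (moebius ((M s : SL(2, ℤ)) : Matrix (Fin 2) (Fin 2) ℤ) α)) := fun s i => by
    have hN2 : 2 ≤ N := by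
      obtain ⟨h0, -, -, h2, -⟩ := (hA i).1.1
      omega
    rw [show α = ((⟨α, hα⟩ : UpperHalfPlane) : ℂ) from rfl, moebius_eq_smul]
    exact isIntegral_Wfun_smul hN2 (hA i) hj (M s)
  refine finsum_induction (IsIntegral ℤ) isIntegral_zero (fun x y hx hy => hx.add hy) fun s => ?_
  have := (integralClosure ℤ ℂ).mvPolynomial_aeval_coe (fun i => ⟨_, hW s i⟩) F
  rw [this]
  exact Subtype.prop (p := fun x => x ∈ integralClosure ℤ ℂ) _
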